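/- (Pach's Theorem without the equal-size restriction.) For every dimension d ≥ 1 there exists a constant c_d > 0 with the following property: for any pairwise disjoint finite point sets P_0, P_1, …, P_d in ℝ^d, there exist a point p ∈ ℝ^d and subsets Q_i ⊆ P_i with |Q_i| ≥ c_d · |P_i| for each i = 0, …, d, such that for every choice of points x_0 ∈ Q_0, x_1 ∈ Q_1, …, x_d ∈ Q_d, the point p lies in the convex hull of {x_0, x_1, …, x_d}. -/

import Mathlib

namespace Pach

open Module SignType

section Cutting

variable {V : Type} [AddCommGroup V] [Module ℝ V]

/-- The signs of `y` on the test vectors `t` determine the sign of `y` at `x`. -/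
def Decides {κ : Type} (t : κ → V) (y : Dual ℝ V) (x : V) : Prop :=
  ∀ y' : Dual ℝ V, (∀ k, sign (y (t k)) = sign (y' (t k))) → sign (y x) = sign (y' x)

lemma Decides.mono {κ κ' : Type} {t : κ → V} {t' : κ' → V} {y : Dual ℝ V} {x : V}
    (h : Decides t y x) (f : κ → κ') (hf : ∀ k, t' (f k) = t k) : Decides t' y x :=
  fun y' hy' => h y' fun k => by simpa [hf] using hy' (f k)

lemma Decides.smul {κ : Type} {t : κ → V} {y : Dual ℝ V} {x : V}
    (h : Decides t y x) (c : ℝ) : Decides t y (c • x) := fun y' hy' => by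
  simp [sign_mul, h y' hy']

lemma Decides.of_smul {κ : Type} {t : κ → V} {y : Dual ℝ V} {x : V} {c : ℝ} (hc : c ≠ 0)
    (h : Decides t y (c • x)) : Decides t y x := by
  simpa [smul_smul, hc] using h.smul c⁻¹

lemma sign_add_eq {a b a' b' : ℝ} (ha : sign a = sign a') (hb : sign b = sign b')
    (hab : 0 ≤ a * b) : sign (a + b) = sign (a' + b') := by
  rcases lt_trichotomy a 0 with h | h | h
  · have ha' : a' < 0 := sign_eq_neg_one_iff.1 (by rw [← ha, sign_neg h])
    have hb0 : b ≤ 0 := by nlinarith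
    have hb' : b' ≤ 0 := by
      by_contra hcon
      rw [sign_pos (not_le.1 hcon), sign_eq_one_iff] at hb
      linarith
    rw [sign_neg (by linarith), sign_neg (by linarith)]
  · subst h
    have : a' = 0 := sign_eq_zero_iff.1 (by simpa using ha.symm)
    simpa [this] using hb
  · have ha' : 0 < a' := sign_eq_one_iff.1 (by rw [← ha, sign_pos h])
    have hb0 : 0 ≤ b := by nlinarith
    have hb' : 0 ≤ b' := by
      by_contra hcon
      rw [sign_neg (not_le.1 hcon), sign_eq_neg_one_iff] at hb
      linarith
    rw [sign_pos (by linarith), sign_pos (by linarith)]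

lemma Decides.add {κ : Type} {t : κ → V} {y : Dual ℝ V} {a b : V}
    (ha : Decides t y a) (hb : Decides t y b) (hab : 0 ≤ y a * y b) : Decides t y (a + b) :=
  fun y' hy' => by
    simpa using sign_add_eq (ha y' hy') (hb y' hy') hab

lemma decides_or_decides {κ : Type} {t : κ → V} {y : Dual ℝ V} {x₁ x₂ : V} {p q : ℝ}
    (hp : 0 < p) (hq : 0 < q) (hz : Decides t y (p • x₁ + q • x₂))
    (hw : Decides t y (x₁ - x₂)) : Decides t y x₁ ∨ Decides t y x₂ := by
  have hpq : p + q ≠ 0 := by positivity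
  rcases le_total 0 (y (p • x₁ + q • x₂) * y (x₁ - x₂)) with h | h
  · left
    refine Decides.of_smul hpq ?_
    have e : (p + q) • x₁ = (p • x₁ + q • x₂) + q • (x₁ - x₂) := by module
    rw [e]
    refine hz.add (hw.smul q) ?_
    rw [map_smul, smul_eq_mul, mul_left_comm]
    positivity
  · right
    refine Decides.of_smul hpq ?_
    have e : (p + q) • x₂ = (p • x₁ + q • x₂) + (-p) • (x₁ - x₂) := by module
    rw [e]
    refine hz.add (hw.smul (-p)) ?_
    rw [map_smul, smul_eq_mul, mul_left_comm]
    nlinarith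

lemma Decides.of_submodule {κ : Type} {U : Submodule ℝ V} {t : κ → U} {y : Dual ℝ V} {x : U}
    (h : Decides t (y ∘ₗ U.subtype) x) : Decides (fun k => (t k : V)) y x :=
  fun y' hy' => h (y' ∘ₗ U.subtype) hy'

end Cutting

/-- In dimension `n`, a bounded number of test vectors leaves at most an `ε`-fraction of any finite
family of vectors undecided. -/
def Cuttable (n : ℕ) : Prop :=
  ∀ ε : ℝ, 0 < ε → ∃ (κ : Type) (_ : Fintype κ),
    ∀ (V : Type) [AddCommGroup V] [Module ℝ V], finrank ℝ V = n →
    ∀ (α : Type) (s : Finset α) (x : α → V), ∃ t : κ → V, ∀ y : Dual ℝ V,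
      open Classical in ((s.filter fun j => ¬ Decides t y (x j)).card : ℝ) ≤ ε * s.card

/-- In dimension `n`, a bounded number of test vectors decides a fixed fraction of any finite
family of vectors. -/
def WeaklyCuttable (n : ℕ) : Prop :=
  ∃ B : ℝ, 0 < B ∧ ∃ (κ : Type) (_ : Fintype κ),
    ∀ (V : Type) [AddCommGroup V] [Module ℝ V], finrank ℝ V = n →
    ∀ (α : Type) (s : Finset α) (x : α → V), ∃ t : κ → V, ∀ y : Dual ℝ V,
      open Classical in B * s.card ≤ ((s.filter fun j => Decides t y (x j)).card : ℝ)

lemma cuttable_one : Cuttable 1 := by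
  classical
  intro ε hε
  refine ⟨Unit, inferInstance, fun V _ _ hV α s x => ?_⟩
  obtain ⟨v, hv, hspan⟩ := finrank_eq_one_iff'.1 hV
  refine ⟨fun _ => v, fun y => ?_⟩
  rw [Finset.filter_false_of_mem, Finset.card_empty]
  · simp only [Nat.cast_zero]; positivity
  · intro j _
    rw [not_not]
    obtain ⟨c, hc⟩ := hspan (x j)
    rw [← hc]
    exact Decides.smul (fun y' hy' => hy' ()) c

lemma WeaklyCuttable.cuttable {n : ℕ} (h : WeaklyCuttable n) : Cuttable n := by
  classical
  obtain ⟨B, hB, κ₀, _, h⟩ := h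
  have key : ∀ m : ℕ, ∃ (κ : Type) (_ : Fintype κ),
      ∀ (V : Type) [AddCommGroup V] [Module ℝ V], finrank ℝ V = n →
      ∀ (α : Type) (s : Finset α) (x : α → V), ∃ t : κ → V, ∀ y : Dual ℝ V,
        ((s.filter fun j => ¬ Decides t y (x j)).card : ℝ) ≤ (max (1 - B) 0) ^ m * s.card := by
    intro m
    induction m with
    | zero =>
      refine ⟨Empty, inferInstance, fun V _ _ hV α s x => ⟨fun k => k.elim, fun y => ?_⟩⟩
      simpa using Finset.card_filter_le _ _
    | succ m ih =>
      obtain ⟨κ, _, ih⟩ := ih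
      refine ⟨κ ⊕ (κ → SignType) × κ₀, inferInstance, fun V _ _ hV α s x => ?_⟩
      obtain ⟨t, ht⟩ := ih V hV α s x
      let u : (κ → SignType) → Finset α := fun π =>
        if hπ : ∃ y : Dual ℝ V, ∀ k, sign (y (t k)) = π k then
          s.filter fun j => ¬ Decides t hπ.choose (x j) else ∅
      choose t' ht' using fun π => h V hV α (u π) x
      refine ⟨Sum.elim t fun p => t' p.1 p.2, fun y => ?_⟩
      set T : κ ⊕ (κ → SignType) × κ₀ → V := Sum.elim t fun p => t' p.1 p.2
      set π : κ → SignType := fun k => sign (y (t k)) with hπdef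
      have hu : u π = s.filter fun j => ¬ Decides t y (x j) := by
        have hπ : ∃ y : Dual ℝ V, ∀ k, sign (y (t k)) = π k := ⟨y, fun _ => rfl⟩
        have hc := hπ.choose_spec
        simp only [u, dif_pos hπ]
        refine Finset.filter_congr fun j _ => not_congr ⟨fun hD y' hy' => ?_, fun hD y' hy' => ?_⟩
        · rw [← hD y' (fun k => (hc k).trans (hy' k)), hD y hc]
        · rw [← hD y' (fun k => (hc k).symm.trans (hy' k)), hD _ (fun k => (hc k).symm)]
      have h1 := ht' π y
      have h2 := ht y
      rw [← hu] at h2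
      have hsub : (s.filter fun j => ¬ Decides T y (x j)) ⊆
          (u π).filter fun j => ¬ Decides (t' π) y (x j) := by
        intro j hj
        rw [Finset.mem_filter] at hj
        rw [Finset.mem_filter, hu, Finset.mem_filter]
        refine ⟨⟨hj.1, fun hD => hj.2 (hD.mono Sum.inl fun _ => rfl)⟩,
          fun hD => hj.2 (hD.mono (fun k => Sum.inr (π, k)) fun _ => rfl)⟩
      have h3 : (((s.filter fun j => ¬ Decides T y (x j)).card : ℕ) : ℝ) ≤
          ((u π).filter fun j => ¬ Decides (t' π) y (x j)).card := by
        exact_mod_cast Finset.card_le_card hsub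
      have h4 : (((u π).filter fun j => Decides (t' π) y (x j)).card : ℝ) +
          ((u π).filter fun j => ¬ Decides (t' π) y (x j)).card = (u π).card := by
        exact_mod_cast Finset.card_filter_add_card_filter_not (s := u π) _
      calc _ ≤ (1 - B) * (u π).card := by linarith
        _ ≤ max (1 - B) 0 * (u π).card := by gcongr; exact le_max_left _ _
        _ ≤ max (1 - B) 0 * (max (1 - B) 0 ^ m * s.card) := by gcongr
        _ = _ := by ring
  intro ε hε
  obtain ⟨m, hm⟩ := exists_pow_lt_of_lt_one hε (show max (1 - B) 0 < 1 by
    rw [max_lt_iff]; constructor <;> linarith)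
  obtain ⟨κ, hκ, H⟩ := key m
  refine ⟨κ, hκ, fun V _ _ hV α s x => ?_⟩
  obtain ⟨t, ht⟩ := H V hV α s x
  exact ⟨t, fun y => (ht y).trans (by gcongr)⟩

lemma exists_median {α : Type} (s : Finset α) (r : α → ℝ) :
    ∃ m : ℝ, (s.card : ℝ) ≤ 2 * ((s.filter fun j => r j ≤ m).card : ℝ) ∧
      (s.card : ℝ) ≤ 2 * ((s.filter fun j => m ≤ r j).card : ℝ) := by
  classical
  rcases s.eq_empty_or_nonempty with rfl | hs
  · exact ⟨0, by simp⟩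
  let A := s.filter fun i => s.card ≤ 2 * (s.filter fun j => r j ≤ r i).card
  have hA : A.Nonempty := by
    obtain ⟨i, hi, hmax⟩ := s.exists_max_image r hs
    refine ⟨i, Finset.mem_filter.2 ⟨hi, ?_⟩⟩
    rw [Finset.filter_true_of_mem hmax]
    omega
  obtain ⟨i, hi, hmin⟩ := A.exists_min_image r hA
  rw [Finset.mem_filter] at hi
  refine ⟨r i, by exact_mod_cast hi.2, ?_⟩
  have hlt : 2 * (s.filter fun j => r j < r i).card ≤ s.card := by
    rcases (s.filter fun j => r j < r i).eq_empty_or_nonempty with h0 | h0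
    · simp [h0]
    · obtain ⟨k, hk, hkmax⟩ := Finset.exists_max_image _ r h0
      rw [Finset.mem_filter] at hk
      have hkA : k ∉ A := fun hkA => absurd (hmin k hkA) (not_le.2 hk.2)
      have hk2 : ¬ s.card ≤ 2 * (s.filter fun j => r j ≤ r k).card :=
        fun h => hkA (Finset.mem_filter.2 ⟨hk.1, h⟩)
      have : (s.filter fun j => r j < r i).card ≤ (s.filter fun j => r j ≤ r k).card :=
        Finset.card_le_card fun j hj => Finset.mem_filter.2
          ⟨(Finset.mem_filter.1 hj).1, hkmax j hj⟩
      omega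
  have hadd : (s.filter fun j => r j < r i).card + (s.filter fun j => r i ≤ r j).card = s.card := by
    simpa only [not_lt] using
      Finset.card_filter_add_card_filter_not (s := s) (fun j => r j < r i)
  exact_mod_cast (by omega : s.card ≤ 2 * (s.filter fun j => r i ≤ r j).card)

/-- The property required of the test index `κ` in `Cuttable n`. -/
def CutsWith (n : ℕ) (ε : ℝ) (κ : Type) : Prop :=
  ∀ (V : Type) [AddCommGroup V] [Module ℝ V], finrank ℝ V = n →
    ∀ (α : Type) (s : Finset α) (x : α → V), ∃ t : κ → V, ∀ y : Dual ℝ V,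
      open Classical in ((s.filter fun j => ¬ Decides t y (x j)).card : ℝ) ≤ ε * s.card

open Classical in
lemma CutsWith.of_ker {n : ℕ} {ε : ℝ} {κ : Type} (h : CutsWith n ε κ)
    {V : Type} [AddCommGroup V] [Module ℝ V] (hV : finrank ℝ V = n + 1) {u : Dual ℝ V}
    (hu : u ≠ 0) {α : Type} (s : Finset α) (x : α → V) (hx : ∀ j ∈ s, u (x j) = 0) :
    ∃ t : κ → V, ∀ y : Dual ℝ V,
      ((s.filter fun j => ¬ Decides t y (x j)).card : ℝ) ≤ ε * s.card := by
  have : Module.Finite ℝ V := Module.finite_of_finrank_pos (by omega)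
  have hker : finrank ℝ (LinearMap.ker u) = n := by
    have := Module.Dual.finrank_ker_add_one_of_ne_zero hu
    omega
  obtain ⟨t, ht⟩ := h (LinearMap.ker u) hker α s
    (fun j => if hj : u (x j) = 0 then ⟨x j, hj⟩ else 0)
  refine ⟨fun k => t k, fun y => le_trans ?_ (ht (y ∘ₗ (LinearMap.ker u).subtype))⟩
  refine Nat.cast_le.2 (Finset.card_le_card fun j hj => ?_)
  rw [Finset.mem_filter] at hj ⊢
  refine ⟨hj.1, fun hD => hj.2 ?_⟩
  rw [dif_pos (hx j hj.1)] at hD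
  exact Decides.of_submodule hD

lemma Cuttable.weaklyCuttable_succ {n : ℕ} (h : Cuttable (n + 1)) : WeaklyCuttable (n + 2) := by
  classical
  obtain ⟨κ, _, hκ⟩ := h (1 / 4) (by norm_num)
  replace hκ : CutsWith (n + 1) (1 / 4) κ := hκ
  refine ⟨1 / 128, by norm_num, κ ⊕ κ, inferInstance, fun V _ _ hV α s x => ?_⟩
  have : Module.Finite ℝ V := Module.finite_of_finrank_pos (by omega)
  let b : Basis (Fin (n + 2)) ℝ V := finBasisOfFinrankEq ℝ V hV
  have ker_case : ∀ (u : Dual ℝ V) (_ : u ≠ 0) (s' : Finset α), s' ⊆ s →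
      (∀ j ∈ s', u (x j) = 0) → (s.card : ℝ) ≤ 8 * s'.card →
      ∃ t : κ ⊕ κ → V, ∀ y : Dual ℝ V,
        1 / 128 * (s.card : ℝ) ≤ ((s.filter fun j => Decides t y (x j)).card : ℝ) := by
    intro u hu s' hs' hx hcard
    obtain ⟨t, ht⟩ := hκ.of_ker hV hu s' x hx
    refine ⟨Sum.elim t t, fun y => ?_⟩
    have h1 := ht y
    have h4 : ((s'.filter fun j => Decides t y (x j)).card : ℝ) +
        (s'.filter fun j => ¬ Decides t y (x j)).card = s'.card := by
      exact_mod_cast Finset.card_filter_add_card_filter_not (s := s') _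
    have h5 : ((s'.filter fun j => Decides t y (x j)).card : ℝ) ≤
        (s.filter fun j => Decides (Sum.elim t t) y (x j)).card := by
      refine Nat.cast_le.2 (Finset.card_le_card fun j hj => ?_)
      rw [Finset.mem_filter] at hj ⊢
      exact ⟨hs' hj.1, hj.2.mono Sum.inl fun _ => rfl⟩
    have : (0 : ℝ) ≤ s'.card := Nat.cast_nonneg _
    linarith
  set u₂ : Dual ℝ V := b.coord 0 with hu₂
  have hu₂0 : u₂ ≠ 0 := fun h0 => by
    have := congrArg (fun f : Dual ℝ V => f (b 0)) h0
    simp [hu₂] at this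
  by_cases hA : (s.card : ℝ) ≤ 2 * (s.filter fun j => u₂ (x j) = 0).card
  · exact ker_case u₂ hu₂0 _ (Finset.filter_subset _ _) (fun j hj => (Finset.mem_filter.1 hj).2)
      (by linarith [Nat.cast_nonneg (α := ℝ) (s.filter fun j => u₂ (x j) = 0).card])
  set s' := s.filter fun j => ¬ u₂ (x j) = 0 with hs'
  have hs's : (s.card : ℝ) ≤ 2 * s'.card := by
    have : ((s.filter fun j => u₂ (x j) = 0).card : ℝ) + s'.card = s.card := by
      exact_mod_cast Finset.card_filter_add_card_filter_not (s := s) _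
    linarith
  set x' : α → V := fun j => (u₂ (x j))⁻¹ • x j with hx'
  have hux' : ∀ j ∈ s', u₂ (x' j) = 1 := fun j hj => by
    simp [hx', inv_mul_cancel₀ (Finset.mem_filter.1 hj).2]
  have hdec : ∀ (κ' : Type) (t : κ' → V) (y : Dual ℝ V), ∀ j ∈ s', Decides t y (x' j) →
      Decides t y (x j) := fun κ' t y j hj hD =>
    Decides.of_smul (inv_ne_zero (Finset.mem_filter.1 hj).2) hD
  set r : α → ℝ := fun j => b.coord 1 (x' j) with hr
  obtain ⟨m, hm1, hm2⟩ := exists_median s' r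
  set u₁ : Dual ℝ V := b.coord 1 - m • u₂ with hu₁
  have hu₁0 : u₁ ≠ 0 := fun h0 => by
    have := congrArg (fun f : Dual ℝ V => f (b 1)) h0
    simp [hu₁, hu₂] at this
  have hu₁x : ∀ j ∈ s', u₁ (x' j) = r j - m := fun j hj => by
    simp only [hu₁, LinearMap.sub_apply, LinearMap.smul_apply, hux' j hj, hr, smul_eq_mul, mul_one]
  by_cases hC : (s'.card : ℝ) ≤ 4 * (s'.filter fun j => r j = m).card
  · refine ker_case u₁ hu₁0 (s'.filter fun j => r j = m)
      ((Finset.filter_subset _ _).trans (Finset.filter_subset _ _)) (fun j hj => ?_) (by linarith)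
    rw [Finset.mem_filter] at hj
    have h0 := hu₁x j hj.1
    rw [hj.2, sub_self, hx', map_smul, smul_eq_mul, mul_eq_zero] at h0
    exact h0.resolve_left (inv_ne_zero (Finset.mem_filter.1 hj.1).2)
  set sp := s'.filter fun j => m < r j with hsp
  set sm := s'.filter fun j => r j < m with hsm
  have hcp : (s'.card : ℝ) ≤ 4 * sp.card := by
    have : ((s'.filter fun j => m ≤ r j).card : ℝ) ≤
        sp.card + (s'.filter fun j => r j = m).card := by
      rw [← Nat.cast_add]
      refine Nat.cast_le.2 ((Finset.card_le_card fun j hj => ?_).trans (Finset.card_union_le _ _))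
      simp only [hsp, Finset.mem_union, Finset.mem_filter] at hj ⊢
      rcases hj.2.lt_or_eq with h | h
      · exact Or.inl ⟨hj.1, h⟩
      · exact Or.inr ⟨hj.1, h.symm⟩
    linarith
  have hcm : (s'.card : ℝ) ≤ 4 * sm.card := by
    have : ((s'.filter fun j => r j ≤ m).card : ℝ) ≤
        sm.card + (s'.filter fun j => r j = m).card := by
      rw [← Nat.cast_add]
      refine Nat.cast_le.2 ((Finset.card_le_card fun j hj => ?_).trans (Finset.card_union_le _ _))
      simp only [hsm, Finset.mem_union, Finset.mem_filter] at hj ⊢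
      rcases hj.2.lt_or_eq with h | h
      · exact Or.inl ⟨hj.1, h⟩
      · exact Or.inr ⟨hj.1, h⟩
    linarith
  obtain ⟨t₁, ht₁⟩ := hκ.of_ker hV hu₁0 (sp ×ˢ sm)
    (fun p => (m - r p.2) • x' p.1 + (r p.1 - m) • x' p.2) (by
      rintro ⟨i, j⟩ hp
      simp only [hsp, hsm, Finset.mem_product, Finset.mem_filter] at hp
      rw [map_add, map_smul u₁ (m - r j) (x' i), map_smul u₁ (r i - m) (x' j), hu₁x i hp.1.1,
        hu₁x j hp.2.1, smul_eq_mul, smul_eq_mul]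
      ring)
  obtain ⟨t₂, ht₂⟩ := hκ.of_ker hV hu₂0 (sp ×ˢ sm) (fun p => x' p.1 - x' p.2) (by
      rintro ⟨i, j⟩ hp
      simp only [hsp, hsm, Finset.mem_product, Finset.mem_filter] at hp
      rw [map_sub, hux' i hp.1.1, hux' j hp.2.1, sub_self])
  refine ⟨Sum.elim t₁ t₂, fun y => ?_⟩
  set t := Sum.elim t₁ t₂
  set R := s.filter fun j => Decides t y (x j) with hR
  have hcover : (sp ×ˢ sm) ⊆
      ((sp ×ˢ sm).filter fun p => ¬ Decides t₁ y ((m - r p.2) • x' p.1 + (r p.1 - m) • x' p.2)) ∪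
      ((sp ×ˢ sm).filter fun p => ¬ Decides t₂ y (x' p.1 - x' p.2)) ∪
      ((R ×ˢ sm) ∪ (sp ×ˢ R)) := by
    rintro ⟨i, j⟩ hp
    have hp' := hp
    simp only [hsp, hsm, Finset.mem_product, Finset.mem_filter] at hp'
    obtain ⟨⟨hi, hi'⟩, hj, hj'⟩ := hp'
    by_cases h1 : Decides t₁ y ((m - r j) • x' i + (r i - m) • x' j)
    · by_cases h2 : Decides t₂ y (x' i - x' j)
      · refine Finset.mem_union_right _ ?_
        rw [Finset.mem_product] at hp
        rcases decides_or_decides (sub_pos.2 hj') (sub_pos.2 hi')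
          (h1.mono (t' := t) Sum.inl fun _ => rfl) (h2.mono (t' := t) Sum.inr fun _ => rfl)
          with h | h
        · refine Finset.mem_union_left _ (Finset.mem_product.2 ⟨?_, hp.2⟩)
          exact Finset.mem_filter.2 ⟨(Finset.mem_filter.1 hi).1, hdec _ t y i hi h⟩
        · refine Finset.mem_union_right _ (Finset.mem_product.2 ⟨hp.1, ?_⟩)
          exact Finset.mem_filter.2 ⟨(Finset.mem_filter.1 hj).1, hdec _ t y j hj h⟩
      · exact Finset.mem_union_left _ (Finset.mem_union_right _ (Finset.mem_filter.2 ⟨hp, h2⟩))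
    · exact Finset.mem_union_left _ (Finset.mem_union_left _ (Finset.mem_filter.2 ⟨hp, h1⟩))
  have hcard := (Finset.card_le_card hcover).trans ((Finset.card_union_le _ _).trans
    (add_le_add (Finset.card_union_le _ _) (Finset.card_union_le _ _)))
  rw [← Nat.cast_le (α := ℝ)] at hcard
  have e1 := ht₁ y
  have e2 := ht₂ y
  simp only [Finset.card_product] at hcard e1 e2
  push_cast at hcard e1 e2
  have hps : (sp.card : ℝ) + sm.card ≤ s.card := by
    have hdisj : Disjoint sp sm := Finset.disjoint_filter.2 fun j _ h1 h2 => lt_asymm h1 h2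
    rw [← Nat.cast_add, ← Finset.card_union_of_disjoint hdisj]
    refine Nat.cast_le.2 (Finset.card_le_card ?_)
    exact (Finset.union_subset (Finset.filter_subset _ _) (Finset.filter_subset _ _)).trans
      (Finset.filter_subset _ _)
  rcases s.eq_empty_or_nonempty with hs0 | hs0
  · simp [hs0]
  have hspos : (0 : ℝ) < s.card := by exact_mod_cast hs0.card_pos
  have hRn : (0 : ℝ) ≤ R.card := Nat.cast_nonneg _
  have f1 : (1 / 2 : ℝ) * (sp.card * sm.card) ≤ R.card * s.card := by nlinarith
  have f2 : (s.card : ℝ) / 8 * (s.card / 8) ≤ sp.card * sm.card := by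
    gcongr <;> linarith
  have f3 : (1 / 128 * (s.card : ℝ)) * s.card ≤ R.card * s.card := by nlinarith
  exact le_of_mul_le_mul_right f3 hspos

theorem cuttable_succ (n : ℕ) : Cuttable (n + 1) := by
  induction n with
  | zero => exact cuttable_one
  | succ n ih => exact ih.weaklyCuttable_succ.cuttable

/-- If a positive fraction of the tuples has a prescribed sign pattern with respect to finitely many
multilinear forms, then there are positive fractions of the classes all of whose tuples have this
sign pattern. -/
theorem exists_homogeneous {V : Type} [AddCommGroup V] [Module ℝ V] {n : ℕ}
    (hV : finrank ℝ V = n + 1) (r : ℕ) : ∀ (κ : Type) [Fintype κ] (β : ℝ), 0 < β →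
    ∃ c : ℝ, 0 < c ∧ ∀ (α : Fin r → Type) [∀ i, Fintype (α i)] [∀ i, Nonempty (α i)]
      (x : ∀ i, α i → V) (f : κ → MultilinearMap ℝ (fun _ : Fin r => V) ℝ) (π : κ → SignType)
      (R : Finset (∀ i, α i)),
      (∀ a ∈ R, ∀ k, sign (f k fun i => x i (a i)) = π k) →
      β * ∏ i, (Fintype.card (α i) : ℝ) ≤ R.card →
      ∃ Q : ∀ i, Finset (α i), (∀ i, c * (Fintype.card (α i) : ℝ) ≤ (Q i).card) ∧
        ∀ a : ∀ i, α i, (∀ i, a i ∈ Q i) → ∀ k, sign (f k fun i => x i (a i)) = π k := by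
  classical
  induction r with
  | zero =>
    intro κ _ β hβ
    refine ⟨1, one_pos, fun α _ _ x f π R hR hcard => ⟨fun _ => ∅, fun i => i.elim0, fun a _ => ?_⟩⟩
    have : 0 < R.card := by
      rw [← Nat.cast_pos (α := ℝ)]
      exact lt_of_lt_of_le (by simpa using hβ) hcard
    obtain ⟨b, hb⟩ := Finset.card_pos.1 this
    rw [Subsingleton.elim a b]
    exact hR b hb
  | succ r ih =>
    intro κ _ β hβ
    set ε : ℝ := β / (2 * (Fintype.card κ + 1)) with hε
    have hε0 : 0 < ε := by positivity
    obtain ⟨κ₀, _, hcut⟩ := cuttable_succ n ε hε0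
    set N : ℝ := (Fintype.card (κ × κ₀ → SignType) : ℝ) with hN
    have hN0 : 0 < N := by rw [hN]; exact_mod_cast Fintype.card_pos
    set γ : ℝ := β / (2 * N) with hγ
    have hγ0 : 0 < γ := by positivity
    obtain ⟨c, hc, ih⟩ := ih (κ × κ₀) γ hγ0
    refine ⟨min γ c, lt_min hγ0 hc, fun α _ _ x f π R hR hcard => ?_⟩
    obtain ⟨t, ht⟩ := hcut V hV (α 0) Finset.univ (x 0)
    let y : κ → (∀ i : Fin r, α i.succ) → Dual ℝ V := fun k a =>
      (f k).toLinearMap (Fin.cons 0 fun i => x i.succ (a i)) 0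
    have hy : ∀ k a v, y k a v = f k (Fin.cons v fun i => x i.succ (a i)) := fun k a v => by
      simp [y, MultilinearMap.toLinearMap]
    have hcons : ∀ (a : ∀ i, α i) k, f k (fun i => x i (a i)) = y k (Fin.tail a) (x 0 (a 0)) := by
      intro a k
      rw [hy]
      congr 1
      funext i
      refine Fin.cases ?_ (fun i => ?_) i <;> simp [Fin.tail]
    let pat : (∀ i : Fin r, α i.succ) → κ × κ₀ → SignType := fun a p => sign (y p.1 a (t p.2))
    set J : ℝ := ∏ i : Fin r, (Fintype.card (α i.succ) : ℝ) with hJ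
    set A : ℝ := (Fintype.card (α 0) : ℝ) with hA
    have hJcard : (Fintype.card (∀ i : Fin r, α i.succ) : ℝ) = J := by
      rw [Fintype.card_pi, hJ]; push_cast; rfl
    have hprod : ∏ i, (Fintype.card (α i) : ℝ) = A * J := Fin.prod_univ_succ _
    rw [hprod] at hcard
    let e : (∀ i, α i) → α 0 × (∀ i : Fin r, α i.succ) := fun a => (a 0, Fin.tail a)
    have he : Function.Injective e := fun a b hab => by
      rw [← Fin.cons_self_tail a, ← Fin.cons_self_tail b]
      rw [Prod.mk.injEq] at hab
      rw [hab.1, hab.2]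
    let bad : κ → Finset (∀ i, α i) := fun k =>
      Finset.univ.filter fun a => ¬ Decides t (y k (Fin.tail a)) (x 0 (a 0))
    have hbad : ∀ k, ((bad k).card : ℝ) ≤ ε * A * J := by
      intro k
      have h1 : (bad k).card ≤ (Finset.univ.sigma fun a : ∀ i : Fin r, α i.succ =>
          Finset.univ.filter fun j => ¬ Decides t (y k a) (x 0 j)).card := by
        refine Finset.card_le_card_of_injOn (fun a => ⟨Fin.tail a, a 0⟩) (fun a ha => ?_)
          (fun a _ b _ hab => he ?_)
        · simpa [bad] using ha
        · simp only [Sigma.mk.injEq, heq_eq_eq] at hab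
          exact Prod.ext hab.2 hab.1
      rw [Finset.card_sigma] at h1
      calc ((bad k).card : ℝ) ≤ ∑ a : ∀ i : Fin r, α i.succ,
            ((Finset.univ.filter fun j => ¬ Decides t (y k a) (x 0 j)).card : ℝ) := by
            exact_mod_cast h1
        _ ≤ ∑ a : ∀ i : Fin r, α i.succ, ε * A :=
            Finset.sum_le_sum fun a _ => by simpa [hA] using ht (y k a)
        _ = ε * A * J := by
            rw [Finset.sum_const, nsmul_eq_mul, Finset.card_univ, hJcard]; ring
    set R' := R \ Finset.univ.biUnion bad with hR'
    have hA1 : 0 < A := by rw [hA]; exact_mod_cast Fintype.card_pos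
    have hJ1 : 0 < J := Finset.prod_pos fun _ _ => by exact_mod_cast Fintype.card_pos
    have hR'card : β / 2 * (A * J) ≤ R'.card := by
      have h1 : (R.card : ℝ) ≤ R'.card + (Finset.univ.biUnion bad).card := by
        rw [← Nat.cast_add]
        exact Nat.cast_le.2 Finset.card_le_card_sdiff_add_card
      have h2 : ((Finset.univ.biUnion bad).card : ℝ) ≤ Fintype.card κ * (ε * A * J) := by
        calc ((Finset.univ.biUnion bad).card : ℝ) ≤ ∑ k, ((bad k).card : ℝ) := by
              exact_mod_cast Finset.card_biUnion_le
          _ ≤ ∑ k : κ, ε * A * J := Finset.sum_le_sum fun k _ => hbad k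
          _ = _ := by rw [Finset.sum_const, nsmul_eq_mul, Finset.card_univ]
      have h3 : Fintype.card κ * ε ≤ β / 2 := by
        rw [hε, mul_div_assoc', div_le_div_iff₀ (by positivity) (by positivity)]
        nlinarith
      nlinarith [mul_le_mul_of_nonneg_right h3 (mul_nonneg hA1.le hJ1.le)]
    obtain ⟨ρ, -, hρ⟩ : ∃ ρ ∈ (Finset.univ : Finset (κ × κ₀ → SignType)),
        γ * (A * J) ≤ ((R'.filter fun a => pat (Fin.tail a) = ρ).card : ℝ) := by
      refine Finset.exists_le_of_sum_le Finset.univ_nonempty ?_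
      have h1 := Finset.card_eq_sum_card_fiberwise (f := fun a => pat (Fin.tail a)) (s := R')
        (t := Finset.univ) (fun _ _ => Finset.mem_coe.2 (Finset.mem_univ _))
      rw [Finset.sum_const, nsmul_eq_mul, Finset.card_univ, ← hN]
      calc N * (γ * (A * J)) = β / 2 * (A * J) := by rw [hγ]; field_simp
        _ ≤ R'.card := hR'card
        _ ≤ _ := by rw [h1]; push_cast; rfl
    set S := R'.filter fun a => pat (Fin.tail a) = ρ with hS
    set Q₀ := S.image fun a => a 0 with hQ₀
    set Y := S.image fun a => (Fin.tail a : ∀ i : Fin r, α i.succ) with hY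
    have hSle : (S.card : ℝ) ≤ Q₀.card * Y.card := by
      rw [← Nat.cast_mul, ← Finset.card_product]
      refine Nat.cast_le.2 (Finset.card_le_card_of_injOn e (fun a ha => ?_) he.injOn)
      exact Finset.mem_coe.2 (Finset.mem_product.2
        ⟨Finset.mem_image_of_mem _ ha, Finset.mem_image_of_mem _ ha⟩)
    have hQ₀le : (Q₀.card : ℝ) ≤ A := by rw [hA]; exact_mod_cast Finset.card_le_univ _
    have hYle : (Y.card : ℝ) ≤ J := by rw [← hJcard]; exact_mod_cast Finset.card_le_univ _
    have hQY : ∀ a₀ ∈ Q₀, ∀ a : ∀ i : Fin r, α i.succ, pat a = ρ →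
        ∀ k, sign (y k a (x 0 a₀)) = π k := by
      intro a₀ ha₀ a ha k
      obtain ⟨b, hb, rfl⟩ := Finset.mem_image.1 ha₀
      rw [hS, Finset.mem_filter, hR', Finset.mem_sdiff] at hb
      have hD : Decides t (y k (Fin.tail b)) (x 0 (b 0)) := by
        by_contra hD
        exact hb.1.2 (Finset.mem_biUnion.2 ⟨k, Finset.mem_univ _, by simpa [bad] using hD⟩)
      rw [← hD (y k a) fun l => congrFun (hb.2.trans ha.symm) (k, l), ← hcons]
      exact hR b hb.1.1 k
    have hYγ : γ * J ≤ Y.card := by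
      refine le_of_mul_le_mul_left ?_ hA1
      nlinarith [mul_le_mul_of_nonneg_right hQ₀le (Nat.cast_nonneg (α := ℝ) Y.card)]
    have hQγ : γ * A ≤ Q₀.card := by
      refine le_of_mul_le_mul_right ?_ hJ1
      nlinarith [mul_le_mul_of_nonneg_left hYle (Nat.cast_nonneg (α := ℝ) Q₀.card)]
    obtain ⟨Q, hQ, hQ'⟩ := ih (fun i => α i.succ) (fun i => x i.succ)
      (fun p => (f p.1).curryLeft (t p.2)) ρ Y (fun a ha p => by
        obtain ⟨b, hb, rfl⟩ := Finset.mem_image.1 ha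
        rw [MultilinearMap.curryLeft_apply, ← hy, ← (Finset.mem_filter.1 hb).2]) hYγ
    refine ⟨Fin.cons Q₀ Q, fun i => ?_, fun a ha k => ?_⟩
    · refine Fin.cases ?_ (fun i => ?_) i
      · exact (mul_le_mul_of_nonneg_right (min_le_left _ _) hA1.le).trans hQγ
      · exact (mul_le_mul_of_nonneg_right (min_le_right _ _) (Nat.cast_nonneg _)).trans (hQ i)
    · rw [hcons]
      refine hQY _ (ha 0) _ ?_ k
      funext p
      have := hQ' (Fin.tail a) (fun i => ha i.succ) p
      rw [MultilinearMap.curryLeft_apply, ← hy] at this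
      exact this

section Cochain

variable {ι : Type} {α : ι → Type}

/-- Families of `ZMod 2`-valued functions on tuples, indexed by sets of colours. -/
abbrev Cochain (α : ι → Type) : Type := Finset ι → (∀ i, α i) → ZMod 2

/-- The value of the cochain at `I` only depends on the coordinates in `I`. -/
def Cochain.IsLocal (C : Cochain α) : Prop :=
  ∀ I a b, (∀ i ∈ I, a i = b i) → C I a = C I b

lemma cochain_add_self (C : Cochain α) : C + C = 0 := by
  funext I a; exact CharTwo.add_self_eq_zero _

lemma Cochain.IsLocal.add {C C' : Cochain α} (h : C.IsLocal) (h' : C'.IsLocal) :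
    (C + C').IsLocal := fun I a b hab => by
  simp [h I a b hab, h' I a b hab]

lemma Cochain.IsLocal.sum {κ : Type*} {s : Finset κ} {C : κ → Cochain α}
    (h : ∀ k ∈ s, (C k).IsLocal) : (∑ k ∈ s, C k).IsLocal := fun I a b hab => by
  simp only [Finset.sum_apply]
  exact Finset.sum_congr rfl fun k hk => h k hk I a b hab

variable [DecidableEq ι]

/-- The simplicial coboundary modulo two. -/
def coboundary (C : Cochain α) : Cochain α := fun I a => ∑ i ∈ I, C (I.erase i) a

/-- Freezing the coordinate of colour `j`. -/
def freeze (j : ι) (y : α j) (C : Cochain α) : Cochain α := fun I a => C I (Function.update a j y)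

/-- The cone homotopy with apex `y` of colour `j`. -/
def coneHomotopy (j : ι) (y : α j) (C : Cochain α) : Cochain α := fun I a =>
  if j ∈ I then 0 else C (insert j I) (Function.update a j y)

lemma coboundary_add (C C' : Cochain α) :
    coboundary (C + C') = coboundary C + coboundary C' := by
  funext I a; simp [coboundary, Finset.sum_add_distrib]

lemma coboundary_sum {κ : Type*} (s : Finset κ) (C : κ → Cochain α) :
    coboundary (∑ k ∈ s, C k) = ∑ k ∈ s, coboundary (C k) := by
  classical
  induction s using Finset.induction_on with
  | empty => funext I a; simp [coboundary]
  | insert k s hk ih => rw [Finset.sum_insert hk, Finset.sum_insert hk, coboundary_add, ih]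

lemma coboundary_freeze (j : ι) (y : α j) (C : Cochain α) :
    coboundary (freeze j y C) = freeze j y (coboundary C) := rfl

lemma coboundary_coneHomotopy (j : ι) (y : α j) (C : Cochain α) :
    coboundary (coneHomotopy j y C) + coneHomotopy j y (coboundary C) = freeze j y C := by
  funext I a
  simp only [Pi.add_apply, coboundary, coneHomotopy, freeze]
  by_cases hj : j ∈ I
  · rw [if_pos hj, add_zero, Finset.sum_eq_single_of_mem j hj]
    · rw [if_neg (by simp), Finset.insert_erase hj]
    · intro i hi hij
      rw [if_pos (Finset.mem_erase.2 ⟨hij.symm, hj⟩)]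
  · rw [if_neg hj, Finset.sum_insert hj, Finset.erase_insert hj]
    have h : ∑ i ∈ I, (if j ∈ I.erase i then 0 else
          C (insert j (I.erase i)) (Function.update a j y)) =
        ∑ i ∈ I, C ((insert j I).erase i) (Function.update a j y) := by
      refine Finset.sum_congr rfl fun i hi => ?_
      have hij : i ≠ j := fun h => hj (h ▸ hi)
      rw [if_neg (fun h => hj (Finset.mem_of_mem_erase h)),
        Finset.erase_insert_of_ne hij.symm]
    rw [h, add_left_comm, CharTwo.add_self_eq_zero, add_zero]

lemma Cochain.IsLocal.freeze {C : Cochain α} (h : C.IsLocal) (j : ι) (y : α j) :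
    (freeze j y C).IsLocal := fun I a b hab => by
  refine h I _ _ fun i hi => ?_
  by_cases hij : i = j
  · subst hij; simp
  · simp [hij, hab i hi]

lemma Cochain.IsLocal.coneHomotopy {C : Cochain α} (h : C.IsLocal) (j : ι) (y : α j) :
    (coneHomotopy j y C).IsLocal := fun I a b hab => by
  simp only [Pach.coneHomotopy]
  split_ifs with hj
  · rfl
  refine h _ _ _ fun i hi => ?_
  by_cases hij : i = j
  · subst hij; simp
  · simp [hij, hab i (Finset.mem_of_mem_insert_of_ne hi hij)]

variable [Fintype ι] [∀ i, Fintype (α i)]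

/-- The size of the support of a cochain. -/
def Cochain.weight (C : Cochain α) : ℕ := by
  classical exact ∑ I, (Finset.univ.filter fun a => C I a ≠ 0).card

lemma Cochain.weight_zero : Cochain.weight (0 : Cochain α) = 0 := by
  simp [Cochain.weight]

lemma Cochain.weight_add_le (C C' : Cochain α) : (C + C').weight ≤ C.weight + C'.weight := by
  classical
  simp only [Cochain.weight]
  rw [← Finset.sum_add_distrib]
  refine Finset.sum_le_sum fun I _ => (Finset.card_le_card ?_).trans (Finset.card_union_le _ _)
  intro a ha
  simp only [Finset.mem_union, Finset.mem_filter, Finset.mem_univ, true_and, Pi.add_apply] at ha ⊢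
  by_contra! h
  exact ha (by rw [h.1, h.2, add_zero])

lemma Cochain.weight_sum_le {κ : Type*} (s : Finset κ) (C : κ → Cochain α) :
    (∑ k ∈ s, C k).weight ≤ ∑ k ∈ s, (C k).weight := by
  classical
  induction s using Finset.induction_on with
  | empty => simp [Cochain.weight_zero]
  | insert k s hk ih =>
    rw [Finset.sum_insert hk, Finset.sum_insert hk]
    exact (weight_add_le _ _).trans (by gcongr)

lemma sum_card_filter_update (j : ι) (p : (∀ i, α i) → Prop) [DecidablePred p] :
    ∑ y : α j, (Finset.univ.filter fun a : ∀ i, α i => p (Function.update a j y)).card =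
      Fintype.card (α j) * (Finset.univ.filter p).card := by
  classical
  rw [← Finset.card_sigma, mul_comm, ← Finset.card_univ, ← Finset.card_product]
  refine Finset.card_bij' (fun z _ => (Function.update z.2 j z.1, z.2 j))
    (fun z _ => ⟨z.1 j, Function.update z.1 j z.2⟩) ?_ ?_ ?_ ?_
  · rintro ⟨y, a⟩ h
    simpa using h
  · rintro ⟨a, y⟩ h
    simpa using h
  · rintro ⟨y, a⟩ h
    simp
  · rintro ⟨a, y⟩ h
    simp

lemma exists_freeze_weight_le [∀ i, Nonempty (α i)] (j : ι) (C : Cochain α) :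
    ∃ y : α j, (freeze j y C).weight + (coneHomotopy j y C).weight ≤ 2 * C.weight := by
  classical
  by_contra! h
  have h1 : ∑ y : α j, (freeze j y C).weight = Fintype.card (α j) * C.weight := by
    simp only [Cochain.weight, freeze]
    rw [Finset.sum_comm, Finset.mul_sum]
    exact Finset.sum_congr rfl fun I _ => sum_card_filter_update j fun a => C I a ≠ 0
  have h2 : ∑ y : α j, (coneHomotopy j y C).weight ≤ Fintype.card (α j) * C.weight := by
    simp only [Cochain.weight, coneHomotopy]
    rw [Finset.sum_comm, Finset.mul_sum,
      ← Finset.sum_subset (Finset.subset_univ (Finset.univ.filter fun I : Finset ι => j ∉ I))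
        (fun I _ hI => Finset.sum_eq_zero fun y _ => by
          have : j ∈ I := by simpa using hI
          simp [this])]
    calc _ = ∑ I ∈ Finset.univ.filter fun I : Finset ι => j ∉ I,
          Fintype.card (α j) * (Finset.univ.filter fun a => C (insert j I) a ≠ 0).card := by
          refine Finset.sum_congr rfl fun I hI => ?_
          have hI : j ∉ I := by simpa using hI
          simp only [hI, if_false]
          exact sum_card_filter_update j fun a => C (insert j I) a ≠ 0
      _ = ∑ I ∈ (Finset.univ.filter fun I : Finset ι => j ∉ I).image (insert j),
          Fintype.card (α j) * (Finset.univ.filter fun a => C I a ≠ 0).card := by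
          rw [Finset.sum_image]
          intro I hI I' hI' hII
          simp only [Finset.coe_filter, Finset.mem_univ, true_and, Set.mem_ofPred_eq] at hI hI'
          rw [← Finset.erase_insert hI, ← Finset.erase_insert hI']
          exact congrArg (fun s => Finset.erase s j) hII
      _ ≤ _ := Finset.sum_le_sum_of_subset (Finset.subset_univ _)
  have h3 : ∑ y : α j, 2 * C.weight <
      ∑ y : α j, ((freeze j y C).weight + (coneHomotopy j y C).weight) :=
    Finset.sum_lt_sum_of_nonempty Finset.univ_nonempty fun y _ => h y
  rw [Finset.sum_add_distrib, Finset.sum_const, smul_eq_mul, Finset.card_univ] at h3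
  nlinarith

lemma exists_partial_filling [∀ i, Nonempty (α i)] {C B : Cochain α} (hC : C.IsLocal)
    (hδ : coboundary C = 0) (hB : B.IsLocal) (hCB : C Finset.univ = coboundary B Finset.univ)
    (J : Finset ι) : ∃ G C' B' : Cochain α, G.IsLocal ∧ C'.IsLocal ∧ B'.IsLocal ∧
      coboundary G = C + C' ∧ G Finset.univ = 0 ∧ coboundary C' = 0 ∧
      C' Finset.univ = coboundary B' Finset.univ ∧ (∀ I, ¬ J ⊆ I → C' I = 0 ∧ B' I = 0) ∧
      G.weight ≤ 3 ^ J.card * C.weight ∧ C'.weight ≤ 3 ^ J.card * C.weight := by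
  induction J using Finset.induction_on with
  | empty =>
    refine ⟨0, C, B, fun _ _ _ _ => rfl, hC, hB, ?_, rfl, hδ, hCB, fun I h => ?_, ?_, ?_⟩
    · rw [cochain_add_self]; funext I a; simp [coboundary]
    · exact absurd (Finset.empty_subset I) h
    · simp [Cochain.weight_zero]
    · simp
  | insert j J hj ih =>
    obtain ⟨G, C', B', hG, hC', hB', hGC, hG1, hδ', hCB', h0, hw, hw'⟩ := ih
    obtain ⟨y, hy⟩ := exists_freeze_weight_le j C'
    have key := coboundary_coneHomotopy j y C'
    have hh0 : coneHomotopy j y (0 : Cochain α) = 0 := by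
      funext I a; simp [coneHomotopy]
    rw [hδ', hh0, add_zero] at key
    refine ⟨G + coneHomotopy j y C', C' + freeze j y C', B' + freeze j y B',
      hG.add (hC'.coneHomotopy j y), hC'.add (hC'.freeze j y), hB'.add (hB'.freeze j y),
      ?_, ?_, ?_, ?_, ?_, ?_, ?_⟩
    · rw [coboundary_add, hGC, key, add_assoc]
    · funext a; simp [hG1, coneHomotopy]
    · rw [coboundary_add, coboundary_freeze, hδ']; rfl
    · rw [coboundary_add, coboundary_freeze, Pi.add_apply, Pi.add_apply, hCB']
      congr 1
      funext a
      exact congrFun hCB' (Function.update a j y)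
    · intro I hI
      by_cases hJ : J ⊆ I
      · have hjI : j ∉ I := fun h => hI (Finset.insert_subset h hJ)
        have hfix : ∀ a, ∀ i ∈ I, Function.update a j y i = a i := fun a i hi => by
          have hij : i ≠ j := fun h => hjI (h ▸ hi)
          rw [Function.update_of_ne hij]
        constructor
        · funext a
          simp only [Pi.add_apply, freeze, Pi.zero_apply]
          rw [hC' I _ _ (hfix a), CharTwo.add_self_eq_zero]
        · funext a
          simp only [Pi.add_apply, freeze, Pi.zero_apply]
          rw [hB' I _ _ (hfix a), CharTwo.add_self_eq_zero]
      · obtain ⟨h1, h2⟩ := h0 I hJ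
        constructor
        · funext a; simp [freeze, h1]
        · funext a; simp [freeze, h2]
    · rw [Finset.card_insert_of_notMem hj, pow_succ]
      have := Cochain.weight_add_le G (coneHomotopy j y C')
      linarith
    · rw [Finset.card_insert_of_notMem hj, pow_succ]
      have := Cochain.weight_add_le C' (freeze j y C')
      linarith

/-- A cofilling inequality for complete multipartite complexes. -/
theorem exists_filling [∀ i, Nonempty (α i)] {C B : Cochain α} (hC : C.IsLocal)
    (hδ : coboundary C = 0) (hB : B.IsLocal) (hCB : C Finset.univ = coboundary B Finset.univ) :
    ∃ G : Cochain α, G.IsLocal ∧ coboundary G = C ∧ G Finset.univ = 0 ∧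
      G.weight ≤ 3 ^ Fintype.card ι * C.weight := by
  obtain ⟨G, C', B', hG, -, -, hGC, hG1, -, hCB', h0, hw, -⟩ :=
    exists_partial_filling hC hδ hB hCB Finset.univ
  refine ⟨G, hG, ?_, hG1, hw⟩
  have hC' : C' = 0 := by
    funext I
    by_cases hI : Finset.univ ⊆ I
    · rw [Finset.univ_subset_iff] at hI
      subst hI
      rw [hCB']
      funext a
      refine Finset.sum_eq_zero fun i _ => ?_
      rw [(h0 _ fun h => by simpa using h (Finset.mem_univ i)).2]; rfl
    · exact (h0 I hI).1
  rw [hGC, hC', add_zero]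

end Cochain

section Radon

lemma even_card_nonneg_relations {κ W : Type} [Fintype κ] [AddCommGroup W] [Module ℝ W]
    [FiniteDimensional ℝ W] (w : κ → W) (hκ : Fintype.card κ = finrank ℝ W + 2)
    (hw : ∀ l : κ → ℝ, ∑ i, l i • w i = 0 → ∀ u v, u ≠ v → l u = 0 → l v = 0 → l = 0)
    (S : Finset κ)
    (hS : ∀ u, u ∈ S ↔ ∃ l : κ → ℝ, (∀ i, 0 ≤ l i) ∧ l ≠ 0 ∧ l u = 0 ∧ ∑ i, l i • w i = 0) :
    Even S.card := by
  classical
  rcases S.eq_empty_or_nonempty with rfl | ⟨u, hu⟩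
  · simp
  obtain ⟨l, hl0, hl, hlu, hlw⟩ := (hS u).1 hu
  have hpos : ∀ v, v ≠ u → 0 < l v := fun v hv =>
    lt_of_le_of_ne (hl0 v) fun h => hl (hw l hlw u v hv.symm hlu h.symm)
  have hnt : ∃ v : κ, v ≠ u := by
    by_contra! h
    exact hl (funext fun v => by rw [h v, hlu]; rfl)
  have hcomb : ∀ μ : κ → ℝ, ∑ i, μ i • w i = 0 → ∀ b : ℝ, ∑ i, (μ + b • l) i • w i = 0 := by
    intro μ hμ b
    simp only [Pi.add_apply, Pi.smul_apply, smul_eq_mul, add_smul, mul_smul,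
      Finset.sum_add_distrib, hμ, ← Finset.smul_sum, hlw]
    simp
  have hmul : ∀ μ : κ → ℝ, ∑ i, μ i • w i = 0 → μ u = 0 → ∃ b : ℝ, μ + b • l = 0 := by
    intro μ hμ hμu
    obtain ⟨v, hv⟩ := hnt
    refine ⟨-(μ v / l v), hw _ (hcomb μ hμ _) u v hv.symm ?_ ?_⟩
    · simp [hμu, hlu]
    · have := (hpos v hv).ne'
      simp; field_simp; ring
  obtain ⟨μ, hμw, hμu⟩ : ∃ μ : κ → ℝ, ∑ i, μ i • w i = 0 ∧ μ u = 1 := by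
    by_contra! h
    have h0 : ∀ μ : κ → ℝ, ∑ i, μ i • w i = 0 → μ u = 0 := by
      intro μ hμ
      by_contra hne
      refine h ((μ u)⁻¹ • μ) ?_ (by simp [hne])
      simp only [Pi.smul_apply, smul_eq_mul, mul_smul, ← Finset.smul_sum, hμ, smul_zero]
    have hker := (Fintype.linearCombination ℝ w).finrank_range_add_finrank_ker
    have hr := Submodule.finrank_le (LinearMap.range (Fintype.linearCombination ℝ w))
    rw [finrank_fintype_fun_eq_card, hκ] at hker
    obtain ⟨v, hv⟩ := hnt
    have hinj := LinearMap.finrank_le_finrank_of_injective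
      (f := (LinearMap.proj v : (κ → ℝ) →ₗ[ℝ] ℝ).comp
        (LinearMap.ker (Fintype.linearCombination ℝ w)).subtype) (by
        rw [← LinearMap.ker_eq_bot, LinearMap.ker_eq_bot']
        rintro ⟨m, hm⟩ hmv
        have hm' : ∑ i, m i • w i = 0 := by
          simpa [Fintype.linearCombination_apply] using hm
        exact Subtype.ext (hw m hm' u v hv.symm (h0 m hm') (by simpa using hmv)))
    rw [finrank_self] at hinj
    omega
  obtain ⟨v, hv, hmax⟩ := Finset.exists_max_image (Finset.univ.erase u)
    (fun v => -(μ v) / l v) (by obtain ⟨v, hv⟩ := hnt; exact ⟨v, by simp [hv]⟩)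
  have hvu : v ≠ u := Finset.ne_of_mem_erase hv
  have hlv := hpos v hvu
  set b := -(μ v) / l v with hb
  have hν0 : ∀ i, 0 ≤ (μ + b • l) i := by
    intro i
    by_cases hi : i = u
    · subst hi; simp [hμu, hlu]
    · have h1 := hmax i (by simp [hi])
      rw [div_le_iff₀ (hpos i hi)] at h1
      simp only [Pi.add_apply, Pi.smul_apply, smul_eq_mul]
      linarith
  have hνu : (μ + b • l) u = 1 := by simp [hμu, hlu]
  have hνv : (μ + b • l) v = 0 := by
    simp only [Pi.add_apply, Pi.smul_apply, smul_eq_mul, hb]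
    field_simp
    ring
  have hSeq : S = {u, v} := by
    ext z
    simp only [Finset.mem_insert, Finset.mem_singleton]
    constructor
    · intro hz
      by_contra! hzne
      obtain ⟨m, hm0, hm, hmz, hmw⟩ := (hS z).1 hz
      have hmu : 0 < m u := lt_of_le_of_ne (hm0 u) fun h => hm (hw m hmw z u hzne.1 hmz h.symm)
      obtain ⟨β, hβ⟩ := hmul (m + (-(m u)) • μ) (by
        simp only [Pi.add_apply, Pi.smul_apply, smul_eq_mul, add_smul, mul_smul,
          Finset.sum_add_distrib, hmw, ← Finset.smul_sum, hμw]
        simp) (by simp [hμu])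
      have hβ' : ∀ i, m i - m u * μ i + β * l i = 0 := fun i => by
        have := congrFun hβ i
        simp only [Pi.add_apply, Pi.smul_apply, smul_eq_mul, Pi.zero_apply] at this
        linarith
      have hlz := hpos z hzne.1
      have h1 := hmax z (by simp [hzne.1])
      rw [div_le_iff₀ hlz] at h1
      have h2 := hβ' z
      rw [hmz] at h2
      have h3 := hβ' v
      have hmv := hm0 v
      have hb' : b * l v = - μ v := by rw [hb]; field_simp
      have hbβ : m u * b + β ≤ 0 := by
        have : (m u * b + β) * l v ≤ 0 := by nlinarith
        by_contra! hc
        exact absurd this (not_le.2 (mul_pos hc hlv))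
      have hbβ' : 0 ≤ m u * b + β := by
        have : 0 ≤ (m u * b + β) * l z := by nlinarith
        by_contra! hc
        exact absurd this (not_le.2 (mul_neg_of_neg_of_pos hc hlz))
      have hmv0 : m v = 0 := by nlinarith
      exact hm (hw m hmw z v hzne.2 hmz hmv0)
    · rintro (rfl | rfl)
      · exact hu
      · exact (hS z).2 ⟨_, hν0, fun h => by rw [h] at hνu; simp at hνu, hνv, hcomb μ hμw b⟩
  rw [hSeq, Finset.card_pair hvu.symm]
  exact even_two

variable {E : Type} [NormedAddCommGroup E] [NormedSpace ℝ E]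

/-- The standard lift of a point to the linear space one dimension higher. -/
def lift (v : E) : E × ℝ := (v, 1)

/-- Small subsets are affinely independent. -/
def GenPos (W : Set E) : Prop :=
  ∀ s : Finset E, (s : Set E) ⊆ W → s.card ≤ finrank ℝ E + 1 → LinearIndepOn ℝ lift (s : Set E)

lemma GenPos.mono {W W' : Set E} (h : GenPos W) (hW : W' ⊆ W) : GenPos W' :=
  fun s hs hc => h s (hs.trans hW) hc

/-- The convex hulls of `s` and `t` intersect. -/
def Meets (s t : Finset E) : Prop := (convexHull ℝ (s : Set E) ∩ convexHull ℝ (t : Set E)).Nonempty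

lemma not_meets_empty_left (t : Finset E) : ¬ Meets ∅ t := by simp [Meets]

lemma not_meets_empty_right (t : Finset E) : ¬ Meets t ∅ := by simp [Meets]

lemma sum_smul_lift (s : Finset E) (l : E → ℝ) :
    ∑ v ∈ s, l v • lift v = (∑ v ∈ s, l v • v, ∑ v ∈ s, l v) := by
  simp [lift, Prod.ext_iff, Prod.fst_sum, Prod.snd_sum]

lemma meets_iff {s t : Finset E} : Meets s t ↔ ∃ l m : E → ℝ, (∀ v ∈ s, 0 ≤ l v) ∧
    (∀ v ∈ t, 0 ≤ m v) ∧ ((∃ v ∈ s, l v ≠ 0) ∨ ∃ v ∈ t, m v ≠ 0) ∧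
    ∑ v ∈ s, l v • lift v = ∑ v ∈ t, m v • lift v := by
  constructor
  · rintro ⟨x, hs, ht⟩
    rw [Finset.mem_convexHull'] at hs ht
    obtain ⟨l, hl, hl1, hlx⟩ := hs
    obtain ⟨m, hm, hm1, hmx⟩ := ht
    refine ⟨l, m, hl, hm, Or.inl ?_, by rw [sum_smul_lift, sum_smul_lift, hl1, hlx, hm1, hmx]⟩
    by_contra! h
    rw [Finset.sum_eq_zero h] at hl1
    exact zero_ne_one hl1
  · rintro ⟨l, m, hl, hm, hne, h⟩
    rw [sum_smul_lift, sum_smul_lift, Prod.mk.injEq] at h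
    have hpos : 0 < ∑ v ∈ s, l v := by
      rcases hne with ⟨v, hv, hv0⟩ | ⟨v, hv, hv0⟩
      · exact Finset.sum_pos' hl ⟨v, hv, lt_of_le_of_ne (hl v hv) hv0.symm⟩
      · rw [h.2]
        exact Finset.sum_pos' hm ⟨v, hv, lt_of_le_of_ne (hm v hv) hv0.symm⟩
    refine ⟨s.centerMass l id, s.centerMass_mem_convexHull hl hpos fun v hv => hv, ?_⟩
    have : s.centerMass l id = t.centerMass m id := by
      simp only [Finset.centerMass, id, h.1, h.2]
    rw [this]
    exact t.centerMass_mem_convexHull hm (h.2 ▸ hpos) fun v hv => hv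

/-- The indicator modulo two of intersecting convex hulls. -/
noncomputable def meet (s t : Finset E) : ZMod 2 := by
  classical exact if Meets s t then 1 else 0

lemma meet_eq_zero {s t : Finset E} (h : ¬ Meets s t) : meet s t = 0 := by
  simp [meet, h]

lemma meet_ne_zero {s t : Finset E} : meet s t ≠ 0 ↔ Meets s t := by
  simp [meet]

variable [FiniteDimensional ℝ E]

lemma even_card_meets [DecidableEq E] {s t : Finset E} (hst : Disjoint s t)
    (hgp : GenPos ((s ∪ t : Finset E) : Set E))
    (hcard : s.card + t.card = finrank ℝ E + 3) (S : Finset E)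
    (hS : ∀ u, u ∈ S ↔ u ∈ s ∪ t ∧ Meets (s.erase u) (t.erase u)) : Even S.card := by
  let ε : E → ℝ := fun v => if v ∈ s then 1 else -1
  have hε : ∀ v, ε v * ε v = 1 := fun v => by simp only [ε]; split_ifs <;> norm_num
  have hsum : ∀ l : E → ℝ, ∑ i : ↥(s ∪ t), l i • (ε i • lift (i : E)) =
      ∑ v ∈ s, l v • lift v - ∑ v ∈ t, l v • lift v := by
    intro l
    rw [Finset.sum_coe_sort (s ∪ t) (fun v => l v • (ε v • lift v)), Finset.sum_union hst,
      sub_eq_add_neg, ← Finset.sum_neg_distrib]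
    congr 1
    · exact Finset.sum_congr rfl fun v hv => by simp [ε, hv]
    · exact Finset.sum_congr rfl fun v hv => by simp [ε, Finset.disjoint_right.1 hst hv]
  have hSub : ∀ u ∈ S, u ∈ s ∪ t := fun u hu => ((hS u).1 hu).1
  have key := even_card_nonneg_relations (κ := ↥(s ∪ t)) (W := E × ℝ)
    (fun i => ε i • lift (i : E)) (by
      rw [Fintype.card_coe, Finset.card_union_of_disjoint hst, hcard, finrank_prod, finrank_self])
    (by
      intro l hl u v huv hlu hlv
      have hcard' : (((s ∪ t).erase u).erase (v : E)).card ≤ finrank ℝ E + 1 := by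
        rw [Finset.card_erase_of_mem (Finset.mem_erase.2
          ⟨fun h => huv (Subtype.ext h.symm), v.2⟩), Finset.card_erase_of_mem u.2,
          Finset.card_union_of_disjoint hst, hcard]
        omega
      have hli := hgp (((s ∪ t).erase u).erase (v : E)) (by
        intro x hx
        exact Finset.mem_of_mem_erase (Finset.mem_of_mem_erase hx)) hcard'
      rw [linearIndepOn_finset_iff] at hli
      let L : E → ℝ := fun x => if h : x ∈ s ∪ t then l ⟨x, h⟩ else 0
      have hL : ∀ i : ↥(s ∪ t), L i = l i := fun i => by simp only [L, i.2, dif_pos]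
      have h0 := hli (fun x => L x * ε x) (by
        rw [Finset.sum_erase, Finset.sum_erase, ← Finset.sum_coe_sort (s ∪ t)
          (fun x => (L x * ε x) • lift x), ← hl]
        · exact Finset.sum_congr rfl fun i _ => by rw [hL, mul_smul]
        · rw [hL, hlu]; simp
        · rw [hL, hlv]; simp)
      funext i
      by_cases hiu : i = u
      · rw [hiu, hlu]; rfl
      by_cases hiv : i = v
      · rw [hiv, hlv]; rfl
      have h1 := h0 i (by
        simp only [Finset.mem_erase, i.2, and_true]
        exact ⟨fun h => hiv (Subtype.ext h), fun h => hiu (Subtype.ext h)⟩)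
      have h2 : l i * ε i * ε i = 0 := by rw [← hL, h1, zero_mul]
      rwa [mul_assoc, hε, mul_one] at h2)
    (S.subtype (· ∈ s ∪ t)) (by
      rintro ⟨u, hu⟩
      rw [Finset.mem_subtype, hS, meets_iff]
      constructor
      · rintro ⟨-, l, m, hl, hm, hne, h⟩
        let L : E → ℝ := fun x => if x = u then 0 else if x ∈ s then l x else m x
        have hLs : ∀ x ∈ s.erase u, L x = l x := fun x hx => by
          simp [L, Finset.ne_of_mem_erase hx, Finset.mem_of_mem_erase hx]
        have hLt : ∀ x ∈ t.erase u, L x = m x := fun x hx => by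
          simp [L, Finset.ne_of_mem_erase hx,
            Finset.disjoint_right.1 hst (Finset.mem_of_mem_erase hx)]
        have hLu : L u = 0 := by simp [L]
        refine ⟨fun i => L i, ?_, ?_, hLu, ?_⟩
        · rintro ⟨x, hx⟩
          by_cases hxu : x = u
          · simp [hxu, hLu]
          rcases Finset.mem_union.1 hx with hx | hx
          · have hx' := Finset.mem_erase.2 ⟨hxu, hx⟩
            simpa [hLs x hx'] using hl x hx'
          · have hx' := Finset.mem_erase.2 ⟨hxu, hx⟩
            simpa [hLt x hx'] using hm x hx'
        · intro h0
          rcases hne with ⟨v, hv, hv0⟩ | ⟨v, hv, hv0⟩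
          · refine hv0 ?_
            rw [← hLs v hv]
            exact congrFun h0 ⟨v, Finset.mem_union_left _ (Finset.mem_of_mem_erase hv)⟩
          · refine hv0 ?_
            rw [← hLt v hv]
            exact congrFun h0 ⟨v, Finset.mem_union_right _ (Finset.mem_of_mem_erase hv)⟩
        · rw [hsum L, ← Finset.sum_erase s (a := u) (by rw [hLu, zero_smul]),
            ← Finset.sum_erase t (a := u) (by rw [hLu, zero_smul]),
            Finset.sum_congr rfl fun x hx => congrArg (· • lift x) (hLs x hx), h,
            Finset.sum_congr (s₂ := t.erase u) rfl fun x hx => congrArg (· • lift x) (hLt x hx),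
            sub_self]
      · rintro ⟨l, hl, hne, hlu, h⟩
        let L : E → ℝ := fun x => if h : x ∈ s ∪ t then l ⟨x, h⟩ else 0
        have hL : ∀ i : ↥(s ∪ t), L i = l i := fun i => by simp only [L, i.2, dif_pos]
        have hL0 : ∀ x, 0 ≤ L x := fun x => by
          simp only [L]; split_ifs
          · exact hl _
          · exact le_rfl
        have hLu : L u = 0 := (hL ⟨u, hu⟩).trans hlu
        refine ⟨hu, L, L, fun v _ => hL0 v, fun v _ => hL0 v, ?_, ?_⟩
        · by_contra! h0
          refine hne (funext fun i => ?_)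
          rw [← hL]
          by_cases hiu : (i : E) = u
          · rw [hiu, hLu]; rfl
          rcases Finset.mem_union.1 i.2 with hi | hi
          · exact h0.1 i (Finset.mem_erase.2 ⟨hiu, hi⟩)
          · exact h0.2 i (Finset.mem_erase.2 ⟨hiu, hi⟩)
        · rw [Finset.sum_erase s (by rw [hLu, zero_smul]),
            Finset.sum_erase t (by rw [hLu, zero_smul]), ← sub_eq_zero, ← hsum L, ← h]
          exact Finset.sum_congr rfl fun i _ => by rw [hL])
  have hc : (S.subtype (· ∈ s ∪ t)).card = S.card := by
    rw [Finset.card_subtype, Finset.filter_true_of_mem hSub]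
  rwa [hc] at key

/-- The mod two boundary formula for intersections of simplices in general position. -/
lemma sum_meet_erase [DecidableEq E] {s t : Finset E} (hst : Disjoint s t)
    (hgp : GenPos ((s ∪ t : Finset E) : Set E)) (hcard : s.card + t.card = finrank ℝ E + 3) :
    ∑ u ∈ s, meet (s.erase u) t = ∑ u ∈ t, meet s (t.erase u) := by
  classical
  have h := even_card_meets hst hgp hcard
    ((s ∪ t).filter fun u => Meets (s.erase u) (t.erase u)) (by simp)
  rw [← CharTwo.add_eq_zero]
  have h1 : ∑ u ∈ s ∪ t, meet (s.erase u) (t.erase u) = 0 := by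
    simp only [meet]
    rw [Finset.sum_boole]
    exact (ZMod.natCast_eq_zero_iff_even).2 h
  rw [Finset.sum_union hst] at h1
  rw [← h1]
  congr 1
  · exact Finset.sum_congr rfl fun u hu => by
      rw [Finset.erase_eq_of_notMem (Finset.disjoint_left.1 hst hu)]
  · exact Finset.sum_congr rfl fun u hu => by
      rw [Finset.erase_eq_of_notMem (Finset.disjoint_right.1 hst hu)]

end Radon

section Generic

variable {E : Type} [NormedAddCommGroup E] [NormedSpace ℝ E]

lemma dense_ne_zero_lift {φ : Dual ℝ (E × ℝ)} (hφ : φ ≠ 0) : Dense {m : E | φ (lift m) ≠ 0} := by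
  intro m
  have hadd : ∀ v : E, ∀ t : ℝ, φ (lift (m + t • v)) = φ (lift m) + t * φ (v, 0) := by
    intro v t
    rw [← smul_eq_mul, ← map_smul, ← map_add]
    simp [lift]
  by_cases hm : φ (lift m) = 0
  · obtain ⟨v, hv⟩ : ∃ v : E, φ (v, 0) ≠ 0 := by
      by_contra! h
      refine hφ (LinearMap.ext fun p => ?_)
      have h1 : φ (0, 1) = 0 := by
        have : lift m = (m, 0) + ((0, 1) : E × ℝ) := by simp [lift]
        rw [this, map_add, h, zero_add] at hm
        exact hm
      have h2 : p = (p.1, 0) + p.2 • ((0, 1) : E × ℝ) := by ext <;> simp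
      rw [h2, map_add, map_smul, h, h1]
      simp
    have ht : Filter.Tendsto (fun t : ℝ => m + t • v) (nhdsWithin 0 {0}ᶜ) (nhds m) := by
      have : Continuous fun t : ℝ => m + t • v := by fun_prop
      have h := this.tendsto 0
      simp only [zero_smul, add_zero] at h
      exact h.mono_left nhdsWithin_le_nhds
    refine mem_closure_of_tendsto ht ?_
    filter_upwards [self_mem_nhdsWithin] with t ht
    simp only [hadd, hm, zero_add]
    exact mul_ne_zero ht hv
  · exact subset_closure hm

variable [FiniteDimensional ℝ E]

lemma GenPos.exists_insert (hd : 1 ≤ finrank ℝ E) {W : Set E} (hW : GenPos W) (hfin : W.Finite)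
    {O : Set E} (hO : IsOpen O) (hne : O.Nonempty) :
    ∃ m ∈ O, m ∉ W ∧ GenPos (insert m W) := by
  classical
  have : CompleteSpace E := FiniteDimensional.complete ℝ E
  have hex : ∀ s : Finset E, ∃ φ : Dual ℝ (E × ℝ), s.card ≤ finrank ℝ E → φ ≠ 0 ∧
      ∀ v ∈ s, φ (lift v) = 0 := by
    intro s
    by_cases hs : s.card ≤ finrank ℝ E
    · have hlt : Submodule.span ℝ ((s.image lift : Finset (E × ℝ)) : Set (E × ℝ)) < ⊤ := by
        refine lt_top_iff_ne_top.2 fun h => ?_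
        have h1 := finrank_span_finset_le_card (R := ℝ) (s.image (lift : E → E × ℝ))
        rw [Set.finrank, h, finrank_top, finrank_prod, finrank_self] at h1
        have h2 : (s.image (lift : E → E × ℝ)).card ≤ s.card := Finset.card_image_le
        omega
      obtain ⟨φ, hφ, hle⟩ := Submodule.exists_le_ker_of_lt_top _ hlt
      exact ⟨φ, fun _ => ⟨hφ, fun v hv => hle (Submodule.subset_span (by
        simpa using ⟨v, hv, rfl⟩))⟩⟩
    · exact ⟨0, fun h => absurd h hs⟩
  choose φ hφ using hex
  let S : Set (Finset E) := {s | s ⊆ hfin.toFinset ∧ s.card ≤ finrank ℝ E}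
  have hS : S.Finite := (hfin.toFinset.powerset.finite_toSet).subset fun s hs => by
    simpa using hs.1
  have hdense : Dense (⋂ s ∈ S, {m : E | φ s (lift m) ≠ 0}) := by
    refine dense_biInter_of_isOpen (fun s _ => ?_) hS.countable fun s hs =>
      dense_ne_zero_lift (hφ s hs.2).1
    have hc : Continuous fun m : E => φ s (lift m) :=
      (LinearMap.continuous_of_finiteDimensional (φ s)).comp (by unfold lift; fun_prop)
    exact isOpen_ne_fun hc continuous_const
  obtain ⟨m, hmO, hm⟩ := hdense.exists_mem_open hO hne
  rw [Set.mem_iInter₂] at hmO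
  have key : ∀ s : Finset E, (s : Set E) ⊆ W → s.card ≤ finrank ℝ E →
      φ s (lift m) ≠ 0 := fun s hs hc => hmO s ⟨fun v hv => by simpa using hs hv, hc⟩
  have hmW : m ∉ W := fun h => key {m} (by simpa using h) (by simpa using hd)
      ((hφ {m} (by simpa using hd)).2 m (by simp))
  refine ⟨m, hm, hmW, fun t ht hc => ?_⟩
  by_cases hmt : m ∈ t
  · have hsub : ((t.erase m : Finset E) : Set E) ⊆ W := fun v hv => by
      rw [Finset.mem_coe, Finset.mem_erase] at hv
      exact (ht hv.2).resolve_left hv.1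
    have hcard : (t.erase m).card ≤ finrank ℝ E := by
      rw [Finset.card_erase_of_mem hmt]; omega
    rw [← Finset.insert_erase hmt, Finset.coe_insert]
    refine (hW _ hsub (by omega)).insert fun hmem => key _ hsub hcard ?_
    have hle : Submodule.span ℝ (lift '' ((t.erase m : Finset E) : Set E)) ≤
        LinearMap.ker (φ (t.erase m)) := by
      rw [Submodule.span_le]
      rintro _ ⟨v, hv, rfl⟩
      exact (hφ _ hcard).2 v hv
    exact hle hmem
  · exact hW t (fun v hv => (ht hv).resolve_left fun h => hmt (h ▸ hv)) hc

/-- A finite set can be perturbed into general position with respect to a given finite set. -/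
lemma GenPos.exists_perturbation (hd : 1 ≤ finrank ℝ E) {W : Set E} (hW : GenPos W)
    (hfin : W.Finite) {O : Set E} (hO : IsOpen O) {ε : ℝ} (hε : 0 < ε) (U : Finset E)
    (hU : (U : Set E) ⊆ O) : ∃ x : E → E, Set.InjOn x U ∧
      (∀ u ∈ U, dist (x u) u < ε ∧ x u ∈ O ∧ x u ∉ W) ∧ GenPos (W ∪ x '' U) := by
  classical
  induction U using Finset.induction_on with
  | empty => exact ⟨id, by simp, by simp, by simpa using hW⟩
  | insert u U hu ih =>
    obtain ⟨x, hinj, hx, hgp⟩ := ih ((Finset.coe_subset.2 (Finset.subset_insert u U)).trans hU)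
    obtain ⟨m, hm, hmW, hgp'⟩ := hgp.exists_insert hd (hfin.union (U.finite_toSet.image x))
      (O := O ∩ Metric.ball u ε) (hO.inter Metric.isOpen_ball)
      ⟨u, hU (by simp), Metric.mem_ball_self hε⟩
    have hne : ∀ v ∈ U, v ≠ u := fun v hv h => hu (h ▸ hv)
    have hup : ∀ v ∈ U, Function.update x u m v = x v := fun v hv =>
      Function.update_of_ne (hne v hv) _ _
    have himg : Function.update x u m '' (U : Set E) = x '' U := Set.image_congr hup
    refine ⟨Function.update x u m, ?_, ?_, ?_⟩
    · rw [Finset.coe_insert, Set.injOn_insert (by simpa using hu), himg, Function.update_self]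
      exact ⟨fun a ha b hb h => hinj ha hb (by rwa [hup a ha, hup b hb] at h),
        fun h => hmW (Or.inr h)⟩
    · intro v hv
      rcases Finset.mem_insert.1 hv with rfl | hv
      · rw [Function.update_self]
        exact ⟨hm.2, hm.1, fun h => hmW (Or.inl h)⟩
      · rw [hup v hv]; exact hx v hv
    · rw [Finset.coe_insert, Set.image_insert_eq, himg, Function.update_self, Set.union_insert]
      exact hgp'

/-- A large simplex, with open neighbourhoods of its facets. -/
lemma exists_big_simplex [DecidableEq E] (U : Finset E) :
    ∃ (D : Finset E) (H : Fin (finrank ℝ E + 1) → Set E)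
    (O : Set E), IsOpen O ∧ Convex ℝ O ∧ (U : Set E) ⊆ O ∧ (∀ i, IsOpen (H i)) ∧
      (∀ i, Convex ℝ (H i)) ∧ (∀ i, Disjoint (H i) O) ∧ D.card = finrank ℝ E + 1 ∧
      GenPos (D : Set E) ∧ O ⊆ convexHull ℝ (D : Set E) ∧
      ∀ p ∈ D, ∃ i, ((D.erase p : Finset E) : Set E) ⊆ H i := by
  obtain ⟨b, hb, -⟩ := exists_mem_interior_convexHull_affineBasis
    (Filter.univ_mem : Set.univ ∈ nhds (0 : E))
  rw [b.interior_convexHull] at hb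
  obtain ⟨i₀, -, hi₀⟩ := Finset.exists_min_image Finset.univ (fun i => b.coord i 0)
    Finset.univ_nonempty
  set η := b.coord i₀ 0 / 2 with hη
  have hη0 : 0 < η := half_pos (hb i₀)
  have hcoord : ∀ i, η < b.coord i 0 := fun i =>
    (half_lt_self (hb i₀)).trans_le (hi₀ i (Finset.mem_univ i))
  have hev : ∀ᶠ t : ℝ in nhdsWithin 0 {0}ᶜ, ∀ u ∈ U, ∀ i, η < b.coord i (t • u) := by
    rw [Filter.eventually_all_finset]
    intro u _
    rw [Filter.eventually_all]
    intro i
    have hc : Continuous fun t : ℝ => b.coord i (t • u) :=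
      (continuous_barycentric_coord b i).comp (by fun_prop)
    exact nhdsWithin_le_nhds (hc.continuousAt.eventually (by
      simpa using lt_mem_nhds (hcoord i)))
  obtain ⟨t, ht, ht0⟩ := (hev.and self_mem_nhdsWithin).exists
  have ht0 : t ≠ 0 := ht0
  set B : AffineBasis (Fin (finrank ℝ E + 1)) ℝ E := (Units.mk0 t ht0)⁻¹ • b with hB
  have hBc : ∀ i v, B.coord i v = b.coord i (t • v) := by
    intro i v
    rw [hB, AffineBasis.coord_smul]
    simp [Units.smul_def]
  have hBinj : Function.Injective B := B.ind.injective
  refine ⟨Finset.univ.image B, fun i => {v | B.coord i v < η}, {v | ∀ i, η < B.coord i v},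
    ?_, ?_, ?_, ?_, ?_, ?_, ?_, ?_, ?_, ?_⟩
  · rw [Set.ofPred_forall]
    exact isOpen_iInter_of_finite fun i =>
      isOpen_lt continuous_const (continuous_barycentric_coord B i)
  · rw [Set.ofPred_forall]
    exact convex_iInter fun i => (convex_Ioi η).affine_preimage (B.coord i)
  · intro u hu i
    rw [hBc]
    exact ht u hu i
  · exact fun i => isOpen_lt (continuous_barycentric_coord B i) continuous_const
  · exact fun i => (convex_Iio η).affine_preimage (B.coord i)
  · exact fun i => Set.disjoint_left.2 fun v hv hv' => lt_asymm hv (hv' i)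
  · rw [Finset.card_image_of_injective _ hBinj, Finset.card_univ, Fintype.card_fin]
  · intro s hs _
    rw [linearIndepOn_finset_iff]
    intro f hf
    rw [sum_smul_lift, Prod.mk_eq_zero] at hf
    have hs' : s = (Finset.univ.filter fun i => B i ∈ s).image B := by
      ext v
      simp only [Finset.mem_image, Finset.mem_filter, Finset.mem_univ, true_and]
      constructor
      · intro hv
        obtain ⟨i, hi⟩ : ∃ i, B i = v := by simpa using hs hv
        exact ⟨i, hi ▸ hv, hi⟩
      · rintro ⟨i, hi, rfl⟩
        exact hi
    rw [hs', Finset.sum_image hBinj.injOn, Finset.sum_image hBinj.injOn] at hf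
    have h := affineIndependent_iff.1 B.ind _ (fun i => f (B i)) hf.2 hf.1
    intro v hv
    obtain ⟨i, hi⟩ : ∃ i, B i = v := by simpa using hs hv
    rw [← hi]
    exact h i (by simpa [hi] using hv)
  · rw [Finset.coe_image, Finset.coe_univ, Set.image_univ, B.convexHull_eq_nonneg_coord]
    exact fun v hv i => (hη0.trans (hv i)).le
  · intro p hp
    obtain ⟨i, -, rfl⟩ := Finset.mem_image.1 hp
    refine ⟨i, fun v hv => ?_⟩
    rw [Finset.mem_coe, Finset.mem_erase, Finset.mem_image] at hv
    obtain ⟨hne, j, -, rfl⟩ := hv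
    have hij : i ≠ j := fun h => hne (by rw [h])
    simpa [B.coord_apply_ne hij] using hη0

end Generic

section Chain

variable {E : Type}

section Bisect

variable [DecidableEq E]

/-- Bisecting the edge `{a, b}` of a simplex. -/
def bisect (a b m : E) (s : Finset E) : Multiset (Finset E) :=
  if a ∈ s ∧ b ∈ s then {insert m (s.erase a), insert m (s.erase b)} else {s}

lemma sum_bisect (a b m : E) (Z : Multiset (Finset E)) (h : Finset E → ZMod 2) :
    ((Z.bind (bisect a b m)).map h).sum = (Z.map fun s =>
      if a ∈ s ∧ b ∈ s then h (insert m (s.erase a)) + h (insert m (s.erase b)) else h s).sum := by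
  rw [Multiset.map_bind, Multiset.sum_bind]
  congr 1
  refine Multiset.map_congr rfl fun s _ => ?_
  by_cases hs : a ∈ s ∧ b ∈ s
  · simp [bisect, hs]
  · simp [bisect, hs]

lemma sum_boundary_bisect {a b m : E} (hab : a ≠ b) {s : Finset E} (hm : m ∉ s)
    (g : Finset E → ZMod 2) :
    (if a ∈ s ∧ b ∈ s then (∑ p ∈ insert m (s.erase a), g ((insert m (s.erase a)).erase p)) +
        ∑ p ∈ insert m (s.erase b), g ((insert m (s.erase b)).erase p)
      else ∑ p ∈ s, g (s.erase p)) =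
    ∑ p ∈ s, if a ∈ s.erase p ∧ b ∈ s.erase p then
      g (insert m ((s.erase p).erase a)) + g (insert m ((s.erase p).erase b))
      else g (s.erase p) := by
  split_ifs with hs
  · obtain ⟨ha, hb⟩ := hs
    have hma : m ∉ s.erase a := fun h => hm (Finset.mem_of_mem_erase h)
    have hmb : m ∉ s.erase b := fun h => hm (Finset.mem_of_mem_erase h)
    have hba : b ∈ s.erase a := Finset.mem_erase.2 ⟨hab.symm, hb⟩
    have hab' : a ∈ s.erase b := Finset.mem_erase.2 ⟨hab, ha⟩
    have hcomm : (s.erase b).erase a = (s.erase a).erase b := Finset.erase_right_comm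
    have hins : ∀ c ∈ s, ∀ p ∈ s.erase c, (insert m (s.erase c)).erase p =
        insert m ((s.erase p).erase c) := by
      intro c _ p hp
      have hpm : m ≠ p := fun h => hm (h ▸ Finset.mem_of_mem_erase hp)
      rw [Finset.erase_insert_of_ne hpm, Finset.erase_right_comm]
    rw [Finset.sum_insert hma, Finset.sum_insert hmb, Finset.erase_insert hma,
      Finset.erase_insert hmb,
      Finset.sum_congr rfl fun p hp => congrArg g (hins a ha p hp),
      Finset.sum_congr (s₂ := s.erase b) rfl fun p hp => congrArg g (hins b hb p hp),
      ← Finset.add_sum_erase _ _ hba, ← Finset.add_sum_erase _ _ hab',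
      ← Finset.add_sum_erase _ _ ha, ← Finset.add_sum_erase _ _ hba, hcomm]
    simp only [Finset.mem_erase, ne_eq, not_true, false_and, and_false, if_false]
    have hrest : ∑ p ∈ (s.erase a).erase b, (if (¬ a = p ∧ a ∈ s) ∧ ¬ b = p ∧ b ∈ s then
          g (insert m ((s.erase p).erase a)) + g (insert m ((s.erase p).erase b))
          else g (s.erase p)) =
        ∑ p ∈ (s.erase a).erase b, g (insert m ((s.erase p).erase a)) +
          ∑ p ∈ (s.erase a).erase b, g (insert m ((s.erase p).erase b)) := by
      rw [← Finset.sum_add_distrib]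
      refine Finset.sum_congr rfl fun p hp => ?_
      rw [Finset.mem_erase, Finset.mem_erase] at hp
      rw [if_pos ⟨⟨fun h => hp.2.1 h.symm, ha⟩, fun h => hp.1 h.symm, hb⟩]
    rw [hrest]
    have h2 := CharTwo.add_self_eq_zero (g (insert m ((s.erase a).erase b)))
    linear_combination h2
  · refine Finset.sum_congr rfl fun p _ => ?_
    rw [if_neg fun h => hs ⟨Finset.mem_of_mem_erase h.1, Finset.mem_of_mem_erase h.2⟩]

end Bisect

variable [NormedAddCommGroup E] [InnerProductSpace ℝ E]

lemma dist_le_of_near_midpoint {a b m v : E} {L : ℝ} (hL : 0 < L) (hab : 9 / 10 * L < dist a b)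
    (ha : dist a v ≤ L) (hb : dist b v ≤ L) (hm : dist m (midpoint ℝ a b) ≤ L / 200) :
    dist m v ≤ 9 / 10 * L := by
  have h := EuclideanGeometry.dist_sq_add_dist_sq_eq_two_mul_dist_midpoint_sq_add_half_dist_sq v a b
  rw [dist_comm v a, dist_comm v b, dist_comm v] at h
  have h1 := dist_triangle m (midpoint ℝ a b) v
  have h2 : dist (midpoint ℝ a b) v ≤ 179 / 200 * L := by
    refine abs_le_of_sq_le_sq' ?_ (by positivity) |>.2
    nlinarith [dist_nonneg (x := a) (y := v), dist_nonneg (x := b) (y := v)]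
  linarith

variable [FiniteDimensional ℝ E] [DecidableEq E] {ι : Type}

/-- A chain modulo two of full-dimensional simplices with vertices in `V`, covering every point of
`X` an odd number of times, and whose boundary lies in the union of the sets `H i`. -/
structure IsChain (X : Finset E) (H : ι → Set E) (V : Finset E) (Z : Multiset (Finset E)) :
    Prop where
  disjoint : Disjoint V X
  genPos : GenPos ((V ∪ X : Finset E) : Set E)
  subset : ∀ s ∈ Z, s ⊆ V
  card_eq : ∀ s ∈ Z, s.card = finrank ℝ E + 1
  boundary : ∀ g : Finset E → ZMod 2, (∀ f : Finset E, (∃ i, (f : Set E) ⊆ H i) → g f = 0) →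
    (Z.map fun s => ∑ p ∈ s, g (s.erase p)).sum = 0
  cover : ∀ x ∈ X, (Z.map fun s => meet s {x}).sum = 1

lemma IsChain.bisect {X V : Finset E} {H : ι → Set E} {Z : Multiset (Finset E)}
    (h : IsChain X H V Z) (hconv : ∀ i, Convex ℝ (H i))
    (hHX : ∀ i, Disjoint (H i) (convexHull ℝ (X : Set E))) {a b m : E} (hab : a ≠ b)
    (hm : m ∉ V ∪ X) (hgp : GenPos (insert m ((V ∪ X : Finset E) : Set E)))
    (hmH : ∀ i, a ∈ H i → b ∈ H i → m ∈ H i) :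
    IsChain X H (insert m V) (Z.bind (bisect a b m)) := by
  have hmV : m ∉ V := fun h => hm (Finset.mem_union_left _ h)
  have hmX : m ∉ X := fun h => hm (Finset.mem_union_right _ h)
  have hms : ∀ s ∈ Z, m ∉ s := fun s hs hms => hmV (h.subset s hs hms)
  have hsub : ∀ s' ∈ Z.bind (Pach.bisect a b m), s' ⊆ insert m V ∧ s'.card = finrank ℝ E + 1 := by
    intro s' hs'
    obtain ⟨s, hs, hs'⟩ := Multiset.mem_bind.1 hs'
    have hcard : ∀ c ∈ s, (insert m (s.erase c)).card = finrank ℝ E + 1 := fun c hc => by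
      rw [Finset.card_insert_of_notMem fun h => hms s hs (Finset.mem_of_mem_erase h),
        Finset.card_erase_add_one hc, h.card_eq s hs]
    have hsb : ∀ c, insert m (s.erase c) ⊆ insert m V := fun c =>
      Finset.insert_subset_insert _ ((Finset.erase_subset _ _).trans (h.subset s hs))
    by_cases hs2 : a ∈ s ∧ b ∈ s
    · simp only [Pach.bisect, hs2, and_self, if_true, Multiset.insert_eq_cons,
        Multiset.mem_cons, Multiset.mem_singleton] at hs'
      rcases hs' with rfl | rfl
      · exact ⟨hsb a, hcard a hs2.1⟩
      · exact ⟨hsb b, hcard b hs2.2⟩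
    · simp only [Pach.bisect, hs2, if_false, Multiset.mem_singleton] at hs'
      subst hs'
      exact ⟨(h.subset _ hs).trans (Finset.subset_insert _ _), h.card_eq _ hs⟩
  refine ⟨?_, ?_, fun s hs => (hsub s hs).1, fun s hs => (hsub s hs).2, ?_, ?_⟩
  · rw [Finset.disjoint_insert_left]
    exact ⟨hmX, h.disjoint⟩
  · rw [Finset.insert_union, Finset.coe_insert]
    exact hgp
  · intro g hg
    rw [sum_bisect, ← h.boundary (fun f => if a ∈ f ∧ b ∈ f then
      g (insert m (f.erase a)) + g (insert m (f.erase b)) else g f)]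
    · congr 1
      exact Multiset.map_congr rfl fun s hs => sum_boundary_bisect hab (hms s hs) g
    · rintro f ⟨i, hi⟩
      split_ifs with hf
      · have hmi := hmH i (hi hf.1) (hi hf.2)
        have : ∀ c, g (insert m (f.erase c)) = 0 := fun c => hg _ ⟨i, by
          rw [Finset.coe_insert]
          exact Set.insert_subset hmi ((Finset.coe_subset.2 (Finset.erase_subset _ _)).trans hi)⟩
        rw [this, this, add_zero]
      · exact hg f ⟨i, hi⟩
  · intro x hx
    rw [sum_bisect, ← h.cover x hx]
    have hb := h.boundary (fun f => if a ∈ f ∧ b ∈ f then meet (insert m f) {x} else 0) (by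
      rintro f ⟨i, hi⟩
      split_ifs with hf
      · refine meet_eq_zero fun ⟨y, hy, hy'⟩ => ?_
        have hmi := hmH i (hi hf.1) (hi hf.2)
        refine Set.disjoint_left.1 (hHX i) (convexHull_min ?_ (hconv i) hy)
          (convexHull_mono ?_ hy')
        · rw [Finset.coe_insert]
          exact Set.insert_subset hmi hi
        · simpa using hx
      · rfl)
    rw [← add_zero (Multiset.map (fun s => meet s {x}) Z).sum, ← hb, ← Multiset.sum_map_add]
    congr 1
    refine Multiset.map_congr rfl fun s hs => ?_
    split_ifs with hs2
    · obtain ⟨ha, hb⟩ := hs2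
      have hmns := hms s hs
      have hxV : x ∉ V := Finset.disjoint_right.1 h.disjoint hx
      have hxm : x ≠ m := fun h => hmX (h ▸ hx)
      have hR := sum_meet_erase (s := insert m s) (t := {x}) (by
          rw [Finset.disjoint_singleton_right, Finset.mem_insert]
          rintro (h1 | h1)
          · exact hxm h1
          · exact hxV (h.subset s hs h1))
        (hgp.mono (by
          intro v hv
          simp only [Finset.coe_union, Finset.coe_insert, Finset.coe_singleton] at hv ⊢
          rcases hv with (hv | hv) | hv
          · exact Or.inl hv
          · exact Or.inr (Or.inl (h.subset s hs hv))
          · rw [Set.mem_singleton_iff] at hv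
            exact Or.inr (Or.inr (hv ▸ hx))))
        (by rw [Finset.card_insert_of_notMem hmns, h.card_eq s hs, Finset.card_singleton])
      have hins : ∀ p ∈ s, (insert m s).erase p = insert m (s.erase p) := fun p hp =>
        Finset.erase_insert_of_ne fun h => hmns (h ▸ hp)
      rw [Finset.sum_singleton, Finset.erase_singleton, meet_eq_zero (not_meets_empty_right _),
        Finset.sum_insert hmns, Finset.erase_insert hmns,
        Finset.sum_congr rfl fun p hp => congrArg (fun t => meet t {x}) (hins p hp)] at hR
      have hba : b ∈ s.erase a := Finset.mem_erase.2 ⟨hab.symm, hb⟩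
      rw [← Finset.add_sum_erase _ _ ha, ← Finset.add_sum_erase _ _ hba] at hR
      rw [← Finset.add_sum_erase _ _ ha, ← Finset.add_sum_erase _ _ hba]
      simp only [Finset.mem_erase, ne_eq, not_true, false_and, and_false, if_false]
      rw [Finset.sum_congr (s₂ := (s.erase a).erase b) rfl fun p hp => if_pos (by
        rw [Finset.mem_erase, Finset.mem_erase] at hp
        exact ⟨⟨fun h => hp.2.1 h.symm, ha⟩, fun h => hp.1 h.symm, hb⟩)]
      generalize ∑ p ∈ (s.erase a).erase b, meet (insert m (s.erase p)) {x} = S at hR ⊢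
      generalize meet s {x} = A at hR ⊢
      generalize meet (insert m (s.erase a)) {x} = B at hR ⊢
      generalize meet (insert m (s.erase b)) {x} = C at hR ⊢
      revert hR; revert A B C S; decide
    · rw [Finset.sum_eq_zero, add_zero]
      intro p _
      rw [if_neg fun h => hs2 ⟨Finset.mem_of_mem_erase h.1, Finset.mem_of_mem_erase h.2⟩]

lemma IsChain.exists_refine (hd : 1 ≤ finrank ℝ E) [Finite ι] {X : Finset E} {H : ι → Set E}
    (hopen : ∀ i, IsOpen (H i)) (hconv : ∀ i, Convex ℝ (H i))
    (hHX : ∀ i, Disjoint (H i) (convexHull ℝ (X : Set E))) {L : ℝ} (hL : 0 < L)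
    (n : ℕ) : ∀ (V : Finset E) (Z : Multiset (Finset E)) (T : Finset (E × E)),
      IsChain X H V Z → T.card = n → (∀ s ∈ Z, ∀ u ∈ s, ∀ v ∈ s, dist u v ≤ L) →
      (∀ s ∈ Z, ∀ u ∈ s, ∀ v ∈ s, 9 / 10 * L < dist u v → (u, v) ∈ T) →
      ∃ V' Z', IsChain X H V' Z' ∧ V ⊆ V' ∧
        ∀ s ∈ Z', ∀ u ∈ s, ∀ v ∈ s, dist u v ≤ 9 / 10 * L := by
  induction n with
  | zero =>
    intro V Z T hZ hT _ hlong
    refine ⟨V, Z, hZ, subset_rfl, fun s hs u hu v hv => ?_⟩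
    by_contra! h
    have := hlong s hs u hu v hv h
    rw [Finset.card_eq_zero.1 hT] at this
    simp at this
  | succ n ih =>
    intro V Z T hZ hT hshort hlong
    by_cases hdone : ∀ s ∈ Z, ∀ u ∈ s, ∀ v ∈ s, dist u v ≤ 9 / 10 * L
    · exact ⟨V, Z, hZ, subset_rfl, hdone⟩
    push Not at hdone
    obtain ⟨s₀, hs₀, a, ha, b, hb, hab⟩ := hdone
    have habT := hlong s₀ hs₀ a ha b hb hab
    have hne : a ≠ b := by
      rintro rfl
      rw [dist_self] at hab
      linarith
    have hO : IsOpen (Metric.ball (midpoint ℝ a b) (L / 200) ∩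
        ⋂ i ∈ {i | a ∈ H i ∧ b ∈ H i}, H i) :=
      Metric.isOpen_ball.inter ((Set.toFinite _).isOpen_biInter fun i _ => hopen i)
    obtain ⟨m, hm, hmW, hgp⟩ := hZ.genPos.exists_insert hd (Finset.finite_toSet _) hO
      ⟨midpoint ℝ a b, Metric.mem_ball_self (by positivity), Set.mem_iInter₂.2 fun i hi =>
        (hconv i).midpoint_mem hi.1 hi.2⟩
    have hmd : dist m (midpoint ℝ a b) ≤ L / 200 := (Metric.mem_ball.1 hm.1).le
    have hnear : ∀ s ∈ Z, a ∈ s → b ∈ s → ∀ v ∈ s, dist m v ≤ 9 / 10 * L :=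
      fun s hs ha hb v hv => dist_le_of_near_midpoint hL hab (hshort s hs a ha v hv)
        (hshort s hs b hb v hv) hmd
    have hcases : ∀ s' ∈ Z.bind (Pach.bisect a b m), ∀ u ∈ s', ∀ v ∈ s', dist u v ≤ 9 / 10 * L ∨
        ((u, v) ≠ (a, b) ∧ ∃ s ∈ Z, u ∈ s ∧ v ∈ s) := by
      intro s' hs' u hu v hv
      obtain ⟨s, hs, hs'⟩ := Multiset.mem_bind.1 hs'
      have hcone : ∀ c, (∀ u' v' : E, u' ≠ c → v' ≠ c → (u', v') ≠ (a, b)) → a ∈ s → b ∈ s →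
          u ∈ insert m (s.erase c) → v ∈ insert m (s.erase c) → dist u v ≤ 9 / 10 * L ∨
        ((u, v) ≠ (a, b) ∧ ∃ s ∈ Z, u ∈ s ∧ v ∈ s) := by
        intro c hc ha hb hu hv
        rw [Finset.mem_insert, Finset.mem_erase] at hu hv
        rcases hu with rfl | ⟨huc, hu⟩
        · rcases hv with rfl | ⟨-, hv⟩
          · left; rw [dist_self]; positivity
          · exact Or.inl (hnear s hs ha hb v hv)
        · rcases hv with rfl | ⟨hvc, hv⟩
          · left; rw [dist_comm]; exact hnear s hs ha hb u hu
          · exact Or.inr ⟨hc u v huc hvc, s, hs, hu, hv⟩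
      by_cases hs2 : a ∈ s ∧ b ∈ s
      · simp only [Pach.bisect, hs2, and_self, if_true, Multiset.insert_eq_cons,
          Multiset.mem_cons, Multiset.mem_singleton] at hs'
        rcases hs' with rfl | rfl
        · exact hcone a (fun u' v' h _ h' => h (Prod.mk.inj h').1) hs2.1 hs2.2 hu hv
        · exact hcone b (fun u' v' _ h h' => h (Prod.mk.inj h').2) hs2.1 hs2.2 hu hv
      · simp only [Pach.bisect, hs2, if_false, Multiset.mem_singleton] at hs'
        subst hs'
        refine Or.inr ⟨fun h => hs2 ?_, _, hs, hu, hv⟩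
        rw [Prod.mk.injEq] at h
        exact ⟨h.1 ▸ hu, h.2 ▸ hv⟩
    obtain ⟨V', Z', hZ', hV', hfin⟩ := ih (insert m V) (Z.bind (Pach.bisect a b m)) (T.erase (a, b))
      (hZ.bisect hconv hHX hne (by simpa using hmW) hgp
        fun i hai hbi => Set.mem_iInter₂.1 hm.2 i ⟨hai, hbi⟩)
      (by rw [Finset.card_erase_of_mem habT, hT]; rfl)
      (by
        intro s hs u hu v hv
        rcases hcases s hs u hu v hv with h | ⟨-, s', hs', hu', hv'⟩
        · linarith
        · exact hshort s' hs' u hu' v hv')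
      (by
        intro s hs u hu v hv huv
        rcases hcases s hs u hu v hv with h | ⟨h, s', hs', hu', hv'⟩
        · exact absurd huv (not_lt.2 h)
        · exact Finset.mem_erase.2 ⟨h, hlong s' hs' u hu' v hv' huv⟩)
    exact ⟨V', Z', hZ', (Finset.subset_insert _ _).trans hV', hfin⟩

lemma IsChain.exists_fine (hd : 1 ≤ finrank ℝ E) [Finite ι] {X : Finset E} {H : ι → Set E}
    (hopen : ∀ i, IsOpen (H i)) (hconv : ∀ i, Convex ℝ (H i))
    (hHX : ∀ i, Disjoint (H i) (convexHull ℝ (X : Set E))) {V : Finset E}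
    {Z : Multiset (Finset E)} (hZ : IsChain X H V Z) {ε : ℝ} (hε : 0 < ε) :
    ∃ V' Z', IsChain X H V' Z' ∧ V ⊆ V' ∧ ∀ s ∈ Z', ∀ u ∈ s, ∀ v ∈ s, dist u v ≤ ε := by
  obtain ⟨L, hL⟩ := Metric.isBounded_iff.1 V.finite_toSet.isBounded
  have hM : 0 < max L 1 := lt_max_of_lt_right one_pos
  have hstep : ∀ k : ℕ, ∃ V' Z', IsChain X H V' Z' ∧ V ⊆ V' ∧
      ∀ s ∈ Z', ∀ u ∈ s, ∀ v ∈ s, dist u v ≤ (9 / 10) ^ k * max L 1 := by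
    intro k
    induction k with
    | zero =>
      refine ⟨V, Z, hZ, subset_rfl, fun s hs u hu v hv => ?_⟩
      rw [pow_zero, one_mul]
      exact (hL (hZ.subset s hs hu) (hZ.subset s hs hv)).trans (le_max_left _ _)
    | succ k ih =>
      obtain ⟨V', Z', hZ', hV, hd'⟩ := ih
      obtain ⟨V'', Z'', hZ'', hV', hd''⟩ := IsChain.exists_refine hd hopen hconv hHX
        (L := (9 / 10) ^ k * max L 1) (by positivity) _ V' Z' (V' ×ˢ V') hZ' rfl hd'
        (fun s hs u hu v hv _ => Finset.mem_product.2 ⟨hZ'.subset s hs hu, hZ'.subset s hs hv⟩)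
      refine ⟨V'', Z'', hZ'', hV.trans hV', ?_⟩
      rw [pow_succ', mul_assoc]
      exact hd''
  obtain ⟨k, hk⟩ := exists_pow_lt_of_lt_one (div_pos hε hM) (by norm_num : (9 / 10 : ℝ) < 1)
  obtain ⟨V', Z', hZ', hV, hd'⟩ := hstep k
  refine ⟨V', Z', hZ', hV, fun s hs u hu v hv => (hd' s hs u hu v hv).trans ?_⟩
  rw [lt_div_iff₀ hM] at hk
  exact hk.le

/-- A finite set of points can be perturbed into a generic set covered by an arbitrarily fine
generic chain whose boundary stays away from the convex hull of the set. -/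
theorem exists_perturbation_and_chain (hd : 1 ≤ finrank ℝ E) (U : Finset E) {ε : ℝ} (hε : 0 < ε) :
    ∃ (x : E → E) (H : Fin (finrank ℝ E + 1) → Set E) (V : Finset E) (Z : Multiset (Finset E)),
      Set.InjOn x U ∧ (∀ u ∈ U, dist (x u) u < ε) ∧ (∀ i, Convex ℝ (H i)) ∧
      (∀ i, Disjoint (H i) (convexHull ℝ ((U.image x : Finset E) : Set E))) ∧
      IsChain (U.image x) H V Z ∧ (∃ p ∈ V, ∃ i, p ∈ H i) ∧
      ∀ s ∈ Z, ∀ u ∈ s, ∀ v ∈ s, dist u v ≤ ε := by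
  obtain ⟨D, H, O, hO, hOc, hUO, hH, hHc, hHO, hDcard, hDgp, hOD, hDH⟩ := exists_big_simplex U
  obtain ⟨x, hinj, hx, hgp⟩ := hDgp.exists_perturbation hd D.finite_toSet hO hε U hUO
  have hXO : convexHull ℝ ((U.image x : Finset E) : Set E) ⊆ O := convexHull_min (by
    intro v hv
    obtain ⟨u, hu, rfl⟩ := Finset.mem_image.1 hv
    exact (hx u hu).2.1) hOc
  have hHX : ∀ i, Disjoint (H i) (convexHull ℝ ((U.image x : Finset E) : Set E)) :=
    fun i => (hHO i).mono_right hXO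
  have hchain : IsChain (U.image x) H D {D} := by
    refine ⟨?_, ?_, by simp, by simpa using hDcard, ?_, ?_⟩
    · rw [Finset.disjoint_right]
      intro v hv
      obtain ⟨u, hu, rfl⟩ := Finset.mem_image.1 hv
      exact (hx u hu).2.2
    · simpa using hgp
    · intro g hg
      rw [Multiset.map_singleton, Multiset.sum_singleton]
      exact Finset.sum_eq_zero fun p hp => hg _ (hDH p hp)
    · intro v hv
      rw [Multiset.map_singleton, Multiset.sum_singleton]
      have : Meets D {v} := ⟨v, hOD (hXO (subset_convexHull ℝ _ hv)), by simp⟩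
      simp [meet, this]
  obtain ⟨V, Z, hZ, hV, hfine⟩ := hchain.exists_fine hd hH hHc hHX hε
  refine ⟨x, H, V, Z, hinj, fun u hu => (hx u hu).1, hHc, hHX, hZ, ?_, hfine⟩
  obtain ⟨p, hp, q, hq, hpq⟩ := Finset.one_lt_card.1 (by omega : 1 < D.card)
  obtain ⟨i, hi⟩ := hDH p hp
  exact ⟨q, hV hq, i, hi (Finset.mem_coe.2 (Finset.mem_erase.2 ⟨hpq.symm, hq⟩))⟩

end Chain

section Crossing

variable {E : Type} [NormedAddCommGroup E] [NormedSpace ℝ E] [DecidableEq E]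
  {α : Fin (finrank ℝ E + 1) → Type}

/-- The points with colours in `I` of a tuple. -/
def pts (y : ∀ i, α i → E) (I : Finset (Fin (finrank ℝ E + 1))) (a : ∀ i, α i) : Finset E :=
  I.image fun i => y i (a i)

/-- The cochain recording the intersections with the simplex `σ` in complementary dimension. -/
noncomputable def crossing (y : ∀ i, α i → E) (σ : Finset E) : Cochain α := fun I a =>
  if σ.card + I.card = finrank ℝ E + 2 then meet σ (pts y I a) else 0

lemma crossing_isLocal (y : ∀ i, α i → E) (σ : Finset E) : (crossing y σ).IsLocal := by
  intro I a b hab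
  have : pts y I a = pts y I b := Finset.image_congr fun i hi => by
    rw [hab i hi]
  simp only [crossing, this]

lemma crossing_eq_zero {y : ∀ i, α i → E} {σ : Finset E} (h : ∀ I a, ¬ Meets σ (pts y I a)) :
    crossing y σ = 0 := by
  funext I a
  simp [crossing, meet_eq_zero (h I a)]

lemma coboundary_crossing [FiniteDimensional ℝ E] {y : ∀ i, α i → E} {V X : Finset E}
    (hgp : GenPos ((V ∪ X : Finset E) : Set E)) (hVX : Disjoint V X) (hy : ∀ i a, y i a ∈ X)
    (hinj : ∀ i j a b, y i a = y j b → i = j) {σ : Finset E} (hσ : σ ⊆ V) :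
    coboundary (crossing y σ) = ∑ p ∈ σ, crossing y (σ.erase p) := by
  funext I a
  have hinj' : Function.Injective fun i => y i (a i) := fun i j h => hinj i j _ _ h
  have hX : pts y I a ⊆ X := fun v hv => by
    obtain ⟨i, -, rfl⟩ := Finset.mem_image.1 hv
    exact hy i _
  have hcard : (pts y I a).card = I.card := Finset.card_image_of_injective _ hinj'
  have herase : ∀ i, pts y (I.erase i) a = (pts y I a).erase (y i (a i)) := fun i =>
    Finset.image_erase hinj' _ _
  simp only [coboundary, crossing, Finset.sum_apply]
  by_cases hc : σ.card + I.card = finrank ℝ E + 3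
  · have h1 : ∀ i ∈ I, (if σ.card + (I.erase i).card = finrank ℝ E + 2 then
        meet σ (pts y (I.erase i) a) else 0) = meet σ ((pts y I a).erase (y i (a i))) := by
      intro i hi
      rw [herase, if_pos]
      have := Finset.card_erase_add_one hi
      omega
    have h2 : ∀ p ∈ σ, (if (σ.erase p).card + I.card = finrank ℝ E + 2 then
        meet (σ.erase p) (pts y I a) else 0) = meet (σ.erase p) (pts y I a) := by
      intro p hp
      rw [if_pos]
      have := Finset.card_erase_add_one hp
      omega
    rw [Finset.sum_congr rfl h1, Finset.sum_congr rfl h2,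
      sum_meet_erase (hVX.mono hσ hX) (hgp.mono (by
        exact_mod_cast Finset.union_subset_union hσ hX)) (by rw [hcard, hc])]
    exact (Finset.sum_image (f := fun u => meet σ ((pts y I a).erase u)) hinj'.injOn).symm
  · rw [Finset.sum_eq_zero, Finset.sum_eq_zero]
    · intro p hp
      rw [if_neg]
      have := Finset.card_erase_add_one hp
      omega
    · intro i hi
      rw [if_neg]
      have := Finset.card_erase_add_one hi
      omega

end Crossing

section Selection

/-- The constants of the iterated cofilling. -/
def fillConst (n : ℕ) : ℕ → ℕ
  | 0 => 0
  | k + 1 => 3 ^ n * (1 + (k + 1) * fillConst n k)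

lemma fillConst_mono (n : ℕ) : Monotone (fillConst n) := by
  refine monotone_nat_of_le_succ fun k => ?_
  have h : 1 ≤ 3 ^ n := Nat.one_le_pow _ _ (by norm_num)
  calc fillConst n k ≤ 1 + (k + 1) * fillConst n k := by nlinarith
    _ ≤ 3 ^ n * (1 + (k + 1) * fillConst n k) := Nat.le_mul_of_pos_left _ h
    _ = fillConst n (k + 1) := rfl

lemma sum_sum_erase_erase {M κ : Type} [AddCommGroup M] [DecidableEq κ] (h2 : ∀ x : M, x + x = 0)
    (s : Finset κ) (G : Finset κ → M) : ∑ p ∈ s, ∑ q ∈ s.erase p, G ((s.erase p).erase q) = 0 := by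
  rw [Finset.sum_sigma']
  refine Finset.sum_involution (fun z _ => ⟨z.2, z.1⟩) ?_ ?_ ?_ ?_
  · rintro ⟨p, q⟩ _
    simp only
    rw [Finset.erase_right_comm, h2]
  · rintro ⟨p, q⟩ h _ heq
    simp only [Finset.mem_sigma, Finset.mem_erase] at h
    exact h.2.1 (Sigma.mk.inj heq).1
  · rintro ⟨p, q⟩ h
    simp only [Finset.mem_sigma, Finset.mem_erase] at h ⊢
    exact ⟨h.2.2, fun h' => h.2.1 h'.symm, h.1⟩
  · rintro ⟨p, q⟩ _
    rfl

variable {E : Type} [NormedAddCommGroup E] [InnerProductSpace ℝ E] [FiniteDimensional ℝ E]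
  [DecidableEq E] {α : Fin (finrank ℝ E + 1) → Type} [∀ i, Fintype (α i)] [∀ i, Nonempty (α i)]
  {ι : Type}

lemma exists_fillings {X V : Finset E} {H : ι → Set E} {Z : Multiset (Finset E)}
    (hZ : IsChain X H V Z) (hconv : ∀ i, Convex ℝ (H i))
    (hHX : ∀ i, Disjoint (H i) (convexHull ℝ (X : Set E))) (hV : ∃ p ∈ V, ∃ i, p ∈ H i)
    {y : ∀ i, α i → E} (hy : ∀ i a, y i a ∈ X) (hinj : ∀ i j a b, y i a = y j b → i = j) {w : ℕ}
    (hw : ∀ σ : Finset E, σ.Nonempty → (∃ s ∈ Z, σ ⊆ s) → (crossing y σ).weight ≤ w) (k : ℕ) :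
    ∃ G : Finset E → Cochain α, (∀ σ : Finset E, (∃ i, (σ : Set E) ⊆ H i) → G σ = 0) ∧
      ∀ σ : Finset E, (∃ s ∈ Z, σ ⊆ s) → σ.card ≤ k → (G σ).IsLocal ∧ G σ Finset.univ = 0 ∧
        coboundary (G σ) = crossing y σ + ∑ p ∈ σ, G (σ.erase p) ∧
        (G σ).weight ≤ fillConst (finrank ℝ E + 1) k * w := by
  classical
  have hptsX : ∀ I a, pts y I a ⊆ X := fun I a v hv => by
    obtain ⟨i, -, rfl⟩ := Finset.mem_image.1 hv
    exact hy i _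
  have hout : ∀ σ : Finset E, (∃ i, (σ : Set E) ⊆ H i) → crossing y σ = 0 := by
    rintro σ ⟨i, hi⟩
    refine crossing_eq_zero fun I a ⟨z, hz, hz'⟩ => ?_
    exact Set.disjoint_left.1 (hHX i) (convexHull_min hi (hconv i) hz)
      (convexHull_mono (by exact_mod_cast hptsX I a) hz')
  have hδ : ∀ σ : Finset E, σ ⊆ V →
      coboundary (crossing y σ) = ∑ p ∈ σ, crossing y (σ.erase p) := fun σ hσ =>
    coboundary_crossing hZ.genPos hZ.disjoint hy hinj hσ
  have hempty : crossing y (∅ : Finset E) = 0 :=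
    crossing_eq_zero fun I a => not_meets_empty_left _
  have hzero : coboundary (0 : Cochain α) = 0 := by funext I a; simp [coboundary]
  induction k with
  | zero =>
    refine ⟨0, fun _ _ => rfl, fun σ _ hσ => ?_⟩
    obtain rfl : σ = ∅ := Finset.card_eq_zero.1 (Nat.le_zero.1 hσ)
    exact ⟨fun _ _ _ _ => rfl, rfl, by simp [hempty, hzero], by simp [Cochain.weight_zero]⟩
  | succ k ih =>
    obtain ⟨G, hG0, hG⟩ := ih
    have hex : ∀ σ : Finset E, ∃ g : Cochain α, (∃ s ∈ Z, σ ⊆ s) → σ.card = k + 1 →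
        g.IsLocal ∧ g Finset.univ = 0 ∧ coboundary g = crossing y σ + ∑ p ∈ σ, G (σ.erase p) ∧
        g.weight ≤ fillConst (finrank ℝ E + 1) (k + 1) * w ∧
        ((∃ i, (σ : Set E) ⊆ H i) → g = 0) := by
      intro σ
      by_cases hσ : (∃ s ∈ Z, σ ⊆ s) ∧ σ.card = k + 1
      swap
      · exact ⟨0, fun h h' => absurd ⟨h, h'⟩ hσ⟩
      obtain ⟨hσZ, hσk⟩ := hσ
      have hσV : σ ⊆ V := by
        obtain ⟨s, hs, hσs⟩ := hσZ
        exact hσs.trans (hZ.subset s hs)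
      have hface : ∀ p ∈ σ, (∃ s ∈ Z, σ.erase p ⊆ s) ∧ (σ.erase p).card = k := by
        intro p hp
        obtain ⟨s, hs, hσs⟩ := hσZ
        exact ⟨⟨s, hs, (Finset.erase_subset _ _).trans hσs⟩, by
          rw [Finset.card_erase_of_mem hp, hσk]; rfl⟩
      have hGf : ∀ p ∈ σ, _ := fun p hp => hG (σ.erase p) (hface p hp).1 (hface p hp).2.le
      by_cases ho : ∃ i, (σ : Set E) ⊆ H i
      · refine ⟨0, fun _ _ => ⟨fun _ _ _ _ => rfl, rfl, ?_, by simp [Cochain.weight_zero],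
          fun _ => rfl⟩⟩
        rw [hzero, hout σ ho, Finset.sum_eq_zero, add_zero]
        intro p _
        obtain ⟨i, hi⟩ := ho
        exact hG0 _ ⟨i, (Finset.coe_subset.2 (Finset.erase_subset _ _)).trans hi⟩
      have hloc : (crossing y σ + ∑ p ∈ σ, G (σ.erase p)).IsLocal :=
        (crossing_isLocal y σ).add (Cochain.IsLocal.sum fun p hp => (hGf p hp).1)
      have hclosed : coboundary (crossing y σ + ∑ p ∈ σ, G (σ.erase p)) = 0 := by
        rw [coboundary_add, coboundary_sum, hδ σ hσV,
          Finset.sum_congr rfl fun p hp => (hGf p hp).2.2.1, Finset.sum_add_distrib,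
          sum_sum_erase_erase cochain_add_self, add_zero, cochain_add_self]
      have hexB : ∃ B : Cochain α, B.IsLocal ∧
          (crossing y σ + ∑ p ∈ σ, G (σ.erase p)) Finset.univ = coboundary B Finset.univ := by
        rcases Nat.eq_zero_or_pos k with rfl | hk
        · obtain ⟨p, rfl⟩ := Finset.card_eq_one.1 hσk
          obtain ⟨q, hqV, i, hqi⟩ := hV
          have hpq : p ≠ q := by
            rintro rfl
            exact ho ⟨i, by simpa using hqi⟩
          refine ⟨crossing y {p, q}, crossing_isLocal y _, ?_⟩
          have hGe : G ∅ = 0 := hG0 ∅ ⟨i, by simp⟩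
          rw [hδ _ (by
            intro v hv
            rcases Finset.mem_insert.1 hv with rfl | hv
            · exact hσV (by simp)
            · rw [Finset.mem_singleton.1 hv]; exact hqV), Finset.sum_pair hpq,
            Finset.sum_singleton, Finset.erase_singleton, hGe]
          have h1 : ({p, q} : Finset E).erase p = {q} := Finset.erase_insert (by simpa using hpq)
          have h2 : ({p, q} : Finset E).erase q = {p} := by
            rw [Finset.pair_comm, Finset.erase_insert (by simpa using hpq.symm)]
          rw [h1, h2, hout {q} ⟨i, by simpa using hqi⟩, zero_add, add_zero]
        · refine ⟨0, fun _ _ _ _ => rfl, ?_⟩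
          rw [hzero]
          funext a
          simp only [Pi.add_apply, Finset.sum_apply, Pi.zero_apply]
          rw [Finset.sum_eq_zero fun p hp => by rw [(hGf p hp).2.1]; rfl, add_zero, crossing,
            if_neg]
          rw [Finset.card_univ, Fintype.card_fin]
          omega
      obtain ⟨B, hB, hCB⟩ := hexB
      obtain ⟨g, hgl, hgδ, hg1, hgw⟩ := exists_filling hloc hclosed hB hCB
      refine ⟨g, fun _ _ => ⟨hgl, hg1, hgδ, hgw.trans ?_, fun h => absurd h ho⟩⟩
      rw [Fintype.card_fin, fillConst, mul_assoc]
      gcongr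
      calc _ ≤ (crossing y σ).weight + (∑ p ∈ σ, G (σ.erase p)).weight :=
            Cochain.weight_add_le _ _
        _ ≤ w + ∑ p ∈ σ, (G (σ.erase p)).weight := by
            gcongr
            · exact hw σ (Finset.card_pos.1 (by omega)) hσZ
            · exact Cochain.weight_sum_le _ _
        _ ≤ w + ∑ p ∈ σ, fillConst (finrank ℝ E + 1) k * w := by
            gcongr with p hp
            exact (hGf p hp).2.2.2
        _ = _ := by rw [Finset.sum_const, hσk, smul_eq_mul]; ring
    choose g hg using hex
    let G' : Finset E → Cochain α := fun σ =>
      if (∃ s ∈ Z, σ ⊆ s) ∧ σ.card = k + 1 then g σ else G σ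
    have hG'f : ∀ σ : Finset E, σ.card ≤ k + 1 → ∀ p ∈ σ, G' (σ.erase p) = G (σ.erase p) := by
      intro σ hσ p hp
      simp only [G']
      rw [if_neg]
      rintro ⟨-, h⟩
      rw [Finset.card_erase_of_mem hp] at h
      omega
    refine ⟨G', fun σ hσ => ?_, fun σ hσZ hσk => ?_⟩
    · simp only [G']
      split_ifs with h
      · exact (hg σ h.1 h.2).2.2.2.2 hσ
      · exact hG0 σ hσ
    · rw [Finset.sum_congr rfl (hG'f σ hσk)]
      by_cases hσ : σ.card = k + 1
      · have : G' σ = g σ := if_pos ⟨hσZ, hσ⟩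
        rw [this]
        obtain ⟨h1, h2, h3, h4, -⟩ := hg σ hσZ hσ
        exact ⟨h1, h2, h3, h4⟩
      · have : G' σ = G σ := if_neg fun h => hσ h.2
        rw [this]
        obtain ⟨h1, h2, h3, h4⟩ := hG σ hσZ (by omega)
        exact ⟨h1, h2, h3, h4.trans (Nat.mul_le_mul_right _ (fillConst_mono _ (Nat.le_succ k)))⟩

lemma exists_crossing_weight {X V : Finset E} {H : ι → Set E} {Z : Multiset (Finset E)}
    (hZ : IsChain X H V Z) (hconv : ∀ i, Convex ℝ (H i))
    (hHX : ∀ i, Disjoint (H i) (convexHull ℝ (X : Set E))) (hV : ∃ p ∈ V, ∃ i, p ∈ H i)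
    {y : ∀ i, α i → E} (hy : ∀ i a, y i a ∈ X) (hinj : ∀ i j a b, y i a = y j b → i = j) {w : ℕ}
    (hw : fillConst (finrank ℝ E + 1) (finrank ℝ E + 1) * w < Fintype.card (∀ i, α i)) :
    ∃ σ : Finset E, σ.Nonempty ∧ (∃ s ∈ Z, σ ⊆ s) ∧ w < (crossing y σ).weight := by
  by_contra! hcon
  obtain ⟨G, hG0, hG⟩ := exists_fillings hZ hconv hHX hV hy hinj hcon (finrank ℝ E + 1)
  obtain ⟨a⟩ : Nonempty (∀ i, α i) := inferInstance
  have htop : ∀ s ∈ Z, meet s {y 0 (a 0)} = ∑ p ∈ s, G (s.erase p) {0} a := by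
    intro s hs
    obtain ⟨hloc, -, hδ, hwt⟩ := hG s ⟨s, hs, subset_rfl⟩ (hZ.card_eq s hs).le
    have h0 : G s ∅ a = 0 := by
      by_contra hne
      refine absurd (hwt.trans_lt hw) (not_lt.2 ?_)
      rw [← Finset.card_univ]
      refine le_trans (Finset.card_le_card ?_) (Finset.single_le_sum
        (f := fun I => (Finset.univ.filter fun b => G s I b ≠ 0).card)
        (fun _ _ => Nat.zero_le _) (Finset.mem_univ ∅))
      intro b _
      rw [Finset.mem_filter, hloc ∅ b a (by simp)]
      exact ⟨Finset.mem_univ _, hne⟩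
    have h1 := congrFun (congrFun hδ {0}) a
    simp only [coboundary, Finset.sum_singleton, Finset.erase_singleton, h0, Pi.add_apply,
      Finset.sum_apply, crossing, Finset.card_singleton, hZ.card_eq s hs, pts,
      Finset.image_singleton] at h1
    rw [if_pos trivial] at h1
    exact CharTwo.add_eq_zero.1 h1.symm
  have h1 := hZ.cover _ (hy 0 (a 0))
  rw [Multiset.map_congr rfl htop, hZ.boundary (fun f => G f {0} a) fun f hf => by
    rw [hG0 f hf]; rfl] at h1
  exact zero_ne_one h1

/-- Some small simplex of the chain meets a positive fraction of the rainbow simplices of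
complementary dimension. -/
theorem exists_dense_crossing {X V : Finset E} {H : ι → Set E} {Z : Multiset (Finset E)}
    (hZ : IsChain X H V Z) (hconv : ∀ i, Convex ℝ (H i))
    (hHX : ∀ i, Disjoint (H i) (convexHull ℝ (X : Set E))) (hV : ∃ p ∈ V, ∃ i, p ∈ H i)
    {y : ∀ i, α i → E} (hy : ∀ i a, y i a ∈ X) (hinj : ∀ i j a b, y i a = y j b → i = j) :
    ∃ (σ : Finset E) (I : Finset (Fin (finrank ℝ E + 1))) (R : Finset (∀ i, α i)),
      σ.Nonempty ∧ (∃ s ∈ Z, σ ⊆ s) ∧ σ.card + I.card = finrank ℝ E + 2 ∧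
      (∀ a ∈ R, Meets σ (pts y I a)) ∧
      (Fintype.card (∀ i, α i) : ℝ) ≤ (fillConst (finrank ℝ E + 1) (finrank ℝ E + 1) + 1) *
        2 ^ (finrank ℝ E + 1) * R.card := by
  classical
  set c := fillConst (finrank ℝ E + 1) (finrank ℝ E + 1) with hc
  set N := Fintype.card (∀ i, α i) with hN
  have hNpos : 0 < N := Fintype.card_pos
  have hdiv := Nat.div_mul_le_self N (c + 1)
  obtain ⟨σ, hσ, hσZ, hw⟩ := exists_crossing_weight (w := N / (c + 1)) hZ hconv hHX hV hy hinj (by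
    rw [← hc, ← hN]
    rcases Nat.eq_zero_or_pos (N / (c + 1)) with h | h
    · rw [h, mul_zero]; exact hNpos
    · nlinarith)
  have hwN : N < (c + 1) * (crossing y σ).weight := by
    have h1 := Nat.lt_mul_div_succ N (Nat.succ_pos c)
    exact h1.trans_le (Nat.mul_le_mul_left _ hw)
  obtain ⟨I, -, hI⟩ : ∃ I ∈ (Finset.univ : Finset (Finset (Fin (finrank ℝ E + 1)))),
      (crossing y σ).weight ≤ 2 ^ (finrank ℝ E + 1) *
        (Finset.univ.filter fun a => crossing y σ I a ≠ 0).card := by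
    by_contra! h
    have h1 := Finset.sum_lt_sum_of_nonempty Finset.univ_nonempty h
    rw [← Finset.mul_sum, Finset.sum_const, Finset.card_univ, Fintype.card_finset,
      Fintype.card_fin, smul_eq_mul] at h1
    refine absurd h1 (not_lt.2 (Nat.mul_le_mul_left _ (le_of_eq ?_)))
    simp only [Cochain.weight]
  have hIcard : N ≤ (c + 1) * 2 ^ (finrank ℝ E + 1) *
      (Finset.univ.filter fun a => crossing y σ I a ≠ 0).card := by
    rw [mul_assoc]
    exact hwN.le.trans (Nat.mul_le_mul_left _ hI)
  have hval : ∀ a, crossing y σ I a ≠ 0 → σ.card + I.card = finrank ℝ E + 2 ∧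
      Meets σ (pts y I a) := by
    intro a ha
    simp only [crossing] at ha
    split_ifs at ha with h
    · exact ⟨h, meet_ne_zero.1 ha⟩
    · exact absurd rfl ha
  refine ⟨σ, I, Finset.univ.filter fun a => crossing y σ I a ≠ 0, hσ, hσZ, ?_, ?_, ?_⟩
  · obtain ⟨a, ha⟩ : (Finset.univ.filter fun a => crossing y σ I a ≠ 0).Nonempty := by
      rw [Finset.nonempty_iff_ne_empty]
      intro h
      rw [h] at hIcard
      simp at hIcard
      omega
    exact (hval a (Finset.mem_filter.1 ha).2).1
  · exact fun a ha => (hval a (Finset.mem_filter.1 ha).2).2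
  · exact_mod_cast hIcard

end Selection

section Homogenization

variable {E : Type} [NormedAddCommGroup E] [NormedSpace ℝ E] [DecidableEq E]

lemma meets_iff_coeff {ι : Type} [Fintype ι] [DecidableEq ι] {u : ι → E} {s : E}
    (hu : LinearIndependent ℝ fun i => lift (u i)) (hs : ∀ i, u i ≠ s) {c : ι → ℝ}
    (hc : lift s = ∑ i, c i • lift (u i)) (I : Finset ι) :
    Meets (insert s (Iᶜ.image u)) (I.image u) ↔ ∀ i, if i ∈ I then 0 ≤ c i else c i ≤ 0 := by
  have hinj : Function.Injective u := fun i j h => hu.injective (by simp only [h])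
  have hsI : s ∉ Iᶜ.image u := fun h => by
    obtain ⟨i, -, hi⟩ := Finset.mem_image.1 h
    exact hs i hi
  rw [meets_iff]
  constructor
  · rintro ⟨l, m, hl, hm, hlm, heq⟩
    rw [Finset.sum_insert hsI, Finset.sum_image hinj.injOn, Finset.sum_image hinj.injOn] at heq
    have hls : 0 ≤ l s := hl s (Finset.mem_insert_self _ _)
    have hl' : ∀ i, i ∉ I → 0 ≤ l (u i) := fun i hi =>
      hl _ (Finset.mem_insert_of_mem (Finset.mem_image_of_mem _ (Finset.mem_compl.2 hi)))
    have hm' : ∀ i ∈ I, 0 ≤ m (u i) := fun i hi => hm _ (Finset.mem_image_of_mem _ hi)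
    have hrel : ∑ i, (l s * c i - if i ∈ I then m (u i) else -l (u i)) • lift (u i) = 0 := by
      have h1 : ∑ i, (l s * c i) • lift (u i) = l s • lift s := by
        rw [hc, Finset.smul_sum]
        simp only [smul_smul]
      have h2 : ∑ i, (if i ∈ I then m (u i) else -l (u i)) • lift (u i) =
          ∑ i ∈ I, m (u i) • lift (u i) - ∑ i ∈ Iᶜ, l (u i) • lift (u i) := by
        rw [← Finset.sum_add_sum_compl I, sub_eq_add_neg, ← Finset.sum_neg_distrib]
        congr 1
        · exact Finset.sum_congr rfl fun i hi => by rw [if_pos hi]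
        · exact Finset.sum_congr rfl fun i hi => by rw [if_neg (Finset.mem_compl.1 hi), neg_smul]
      simp only [sub_smul, Finset.sum_sub_distrib]
      rw [h1, h2, ← heq]
      abel
    have hcoef : ∀ i, l s * c i = if i ∈ I then m (u i) else -l (u i) := fun i =>
      sub_eq_zero.1 (Fintype.linearIndependent_iff.1 hu _ hrel i)
    have hpos : 0 < l s := by
      refine hls.lt_of_ne fun h0 => ?_
      simp only [← h0, zero_mul] at hcoef
      rcases hlm with ⟨v, hv, hne⟩ | ⟨v, hv, hne⟩
      · rcases Finset.mem_insert.1 hv with rfl | hv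
        · exact hne h0.symm
        · obtain ⟨i, hi, rfl⟩ := Finset.mem_image.1 hv
          have := hcoef i
          rw [if_neg (Finset.mem_compl.1 hi)] at this
          exact hne (neg_eq_zero.1 this.symm)
      · obtain ⟨i, hi, rfl⟩ := Finset.mem_image.1 hv
        have := hcoef i
        rw [if_pos hi] at this
        exact hne this.symm
    intro i
    have := hcoef i
    split_ifs at this ⊢ with hi
    · exact nonneg_of_mul_nonneg_right (this ▸ hm' i hi) hpos
    · exact nonpos_of_mul_nonpos_right (this ▸ neg_nonpos.2 (hl' i hi)) hpos
  · intro h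
    have hne : Nonempty ι := by
      by_contra hemp
      rw [not_nonempty_iff] at hemp
      simp [lift] at hc
    have hinv : ∀ i, Function.invFun u (u i) = i := Function.leftInverse_invFun hinj
    refine ⟨fun v => if v = s then 1 else -c (Function.invFun u v),
      fun v => c (Function.invFun u v), ?_, ?_, ?_, ?_⟩
    · intro v hv
      rcases Finset.mem_insert.1 hv with rfl | hv
      · simp
      · obtain ⟨i, hi, rfl⟩ := Finset.mem_image.1 hv
        have := h i
        rw [if_neg (Finset.mem_compl.1 hi)] at this
        simpa [hs i, hinv] using this
    · intro v hv
      obtain ⟨i, hi, rfl⟩ := Finset.mem_image.1 hv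
      have := h i
      rw [if_pos hi] at this
      simpa [hinv] using this
    · exact Or.inl ⟨s, Finset.mem_insert_self _ _, by simp⟩
    · rw [Finset.sum_insert hsI, Finset.sum_image hinj.injOn, Finset.sum_image hinj.injOn]
      simp only [hs, hinv, if_true, if_false, one_smul, neg_smul, Finset.sum_neg_distrib]
      rw [hc, ← Finset.sum_add_sum_compl I]
      abel

/-- The determinants governing the expansion of a vector `s` in a family of vectors on which `ℓ`
takes the value one. -/
noncomputable def cramerForm {W : Type} [AddCommGroup W] [Module ℝ W] {r : ℕ}
    (b : Basis (Fin r) ℝ W) (ℓ : W →ₗ[ℝ] ℝ) (s : W) :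
    Option (Fin r) → MultilinearMap ℝ (fun _ : Fin r => W) ℝ
  | none => b.det.toMultilinearMap
  | some i => b.det.toMultilinearMap.compLinearMap
      (Function.update (fun _ => LinearMap.id) i (ℓ.smulRight s))

lemma cramerForm_some {W : Type} [AddCommGroup W] [Module ℝ W] {r : ℕ} (b : Basis (Fin r) ℝ W)
    {ℓ : W →ₗ[ℝ] ℝ} {s : W} {v : Fin r → W} (hv : ∀ i, ℓ (v i) = 1) {c : Fin r → ℝ}
    (hc : s = ∑ i, c i • v i) (i : Fin r) :
    cramerForm b ℓ s (some i) v = c i * cramerForm b ℓ s none v := by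
  have h1 : cramerForm b ℓ s (some i) v = b.det (Function.update v i s) := by
    simp only [cramerForm, MultilinearMap.compLinearMap_apply]
    change b.det _ = _
    congr 1
    funext j
    rcases eq_or_ne j i with rfl | hj
    · simp [hv]
    · simp [hj]
  rw [h1, hc, AlternatingMap.map_update_sum]
  simp only [AlternatingMap.map_update_smul]
  rw [Finset.sum_eq_single i]
  · simp [cramerForm]
  · intro j _ hj
    rw [AlternatingMap.map_update_self _ _ hj.symm, smul_zero]
  · simp

lemma meets_congr_of_sign {r : ℕ} (b : Basis (Fin r) ℝ (E × ℝ)) {u u' : Fin r → E} {s : E}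
    (hu : LinearIndependent ℝ fun i => lift (u i)) (hs : ∀ i, u i ≠ s)
    (hu' : LinearIndependent ℝ fun i => lift (u' i)) (hs' : ∀ i, u' i ≠ s)
    (hsign : ∀ k, sign (cramerForm b (LinearMap.snd ℝ E ℝ) (lift s) k fun i => lift (u i)) =
      sign (cramerForm b (LinearMap.snd ℝ E ℝ) (lift s) k fun i => lift (u' i)))
    (I : Finset (Fin r)) :
    Meets (insert s (Iᶜ.image u)) (I.image u) ↔ Meets (insert s (Iᶜ.image u')) (I.image u') := by
  have hspan : ∀ u : Fin r → E, LinearIndependent ℝ (fun i => lift (u i)) →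
      (cramerForm b (LinearMap.snd ℝ E ℝ) (lift s) none fun i => lift (u i)) ≠ 0 ∧
      ∃ c : Fin r → ℝ, lift s = ∑ i, c i • lift (u i) := by
    intro u hu
    have : FiniteDimensional ℝ (E × ℝ) := b.finiteDimensional_of_finite
    have htop : ⊤ ≤ Submodule.span ℝ (Set.range fun i => lift (u i)) :=
      (hu.span_eq_top_of_card_eq_finrank' (by rw [finrank_eq_card_basis b])).ge
    refine ⟨((Basis.is_basis_iff_det b).1 ⟨hu, htop.antisymm' le_top⟩).ne_zero, ?_⟩
    obtain ⟨c, hc⟩ := (Submodule.mem_span_range_iff_exists_fun ℝ).1 (htop (x := lift s) trivial)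
    exact ⟨c, hc.symm⟩
  obtain ⟨hD, c, hc⟩ := hspan u hu
  obtain ⟨hD', c', hc'⟩ := hspan u' hu'
  have hcc : ∀ i, sign (c i) = sign (c' i) := by
    intro i
    have h := hsign (some i)
    rw [cramerForm_some b (fun _ => rfl) hc, cramerForm_some b (fun _ => rfl) hc', sign_mul,
      sign_mul, hsign none] at h
    exact mul_right_cancel₀ (sign_ne_zero.2 hD') h
  rw [meets_iff_coeff hu hs hc, meets_iff_coeff hu' hs' hc']
  refine forall_congr' fun i => ?_
  split_ifs
  · rw [← sign_nonneg_iff, hcc, sign_nonneg_iff]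
  · rw [← sign_nonpos_iff, hcc, sign_nonpos_iff]

end Homogenization

section Meets

variable {E : Type} [NormedAddCommGroup E] [NormedSpace ℝ E] [FiniteDimensional ℝ E]
  [DecidableEq E]

/-- A simplex meeting a positive fraction of the rainbow simplices of complementary dimension meets
all rainbow simplices of suitable large colour classes. -/
lemma exists_homogeneous_meets {β : ℝ} (hβ : 0 < β) : ∃ c : ℝ, 0 < c ∧
    ∀ (α : Fin (finrank ℝ E + 1) → Type) [∀ i, Fintype (α i)] [∀ i, Nonempty (α i)]
      (V X : Finset E) (_ : Disjoint V X) (_ : GenPos ((V ∪ X : Finset E) : Set E))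
      (y : ∀ i, α i → E) (_ : ∀ i a, y i a ∈ X) (_ : ∀ i j a b, y i a = y j b → i = j)
      (σ : Finset E) (_ : σ ⊆ V) (_ : σ.Nonempty) (I : Finset (Fin (finrank ℝ E + 1)))
      (_ : σ.card + I.card = finrank ℝ E + 2) (R : Finset (∀ i, α i)),
      (∀ a ∈ R, Meets σ (pts y I a)) → β * ∏ i, (Fintype.card (α i) : ℝ) ≤ R.card →
      ∃ Q : ∀ i, Finset (α i), (∀ i, c * (Fintype.card (α i) : ℝ) ≤ (Q i).card) ∧
        ∀ a, (∀ i, a i ∈ Q i) → Meets σ (pts y I a) := by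
  classical
  have hfr : finrank ℝ (E × ℝ) = finrank ℝ E + 1 := by simp
  let b : Basis (Fin (finrank ℝ E + 1)) ℝ (E × ℝ) := finBasisOfFinrankEq ℝ _ hfr
  let N : ℝ := (Finset.univ : Finset (Option (Fin (finrank ℝ E + 1)) → SignType)).card
  have hN : 0 < N := by
    simp only [N, Nat.cast_pos]
    exact Finset.card_pos.2 Finset.univ_nonempty
  obtain ⟨c, hc, hhom⟩ := exists_homogeneous hfr (finrank ℝ E + 1)
    (Option (Fin (finrank ℝ E + 1))) (β / N) (by positivity)
  refine ⟨c, hc, ?_⟩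
  intro α _ _ V X hVX hgp y hy hinj σ hσV hσ I hcard R hR hRcard
  obtain ⟨s, hs⟩ := hσ
  have hprod : 0 < ∏ i, (Fintype.card (α i) : ℝ) :=
    Finset.prod_pos fun i _ => by exact_mod_cast Fintype.card_pos
  obtain ⟨w, hwinj, hwim⟩ : ∃ w : Fin (finrank ℝ E + 1) → E,
      Set.InjOn w (Iᶜ : Finset (Fin (finrank ℝ E + 1))) ∧ Iᶜ.image w = σ.erase s := by
    have hce : Iᶜ.card = (σ.erase s).card := by
      have h1 := Finset.card_erase_add_one hs
      have h2 := Finset.card_compl_add_card I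
      rw [Fintype.card_fin] at h2
      omega
    let e := Finset.equivOfCardEq hce
    refine ⟨fun i => if h : i ∈ Iᶜ then e ⟨i, h⟩ else s, ?_, ?_⟩
    · intro i hi j hj hij
      simp only [Finset.mem_coe] at hi hj
      simp only [hi, hj, dif_pos] at hij
      exact congrArg Subtype.val (e.injective (Subtype.ext hij))
    · ext v
      rw [Finset.mem_image]
      constructor
      · rintro ⟨i, hi, rfl⟩
        simp only [hi, dif_pos]
        exact (e ⟨i, hi⟩).2
      · intro hv
        refine ⟨e.symm ⟨v, hv⟩, (e.symm ⟨v, hv⟩).2, ?_⟩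
        simp only [Finset.coe_mem, dif_pos, Subtype.coe_eta, Equiv.apply_symm_apply]
  let u : (∀ i, α i) → Fin (finrank ℝ E + 1) → E := fun a i => if i ∈ I then y i (a i) else w i
  have huI : ∀ a, ∀ i ∈ I, u a i = y i (a i) := fun a i hi => if_pos hi
  have huI' : ∀ a, ∀ i ∈ Iᶜ, u a i = w i := fun a i hi => if_neg (Finset.mem_compl.1 hi)
  have hw : ∀ i, i ∉ I → w i ∈ σ.erase s := fun i hi =>
    hwim ▸ Finset.mem_image_of_mem _ (Finset.mem_compl.2 hi)
  have hwV : ∀ i, i ∉ I → w i ∈ V := fun i hi => hσV (Finset.mem_of_mem_erase (hw i hi))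
  have hsX : s ∉ X := Finset.disjoint_left.1 hVX (hσV hs)
  have hus : ∀ a i, u a i ≠ s := by
    intro a i
    by_cases hi : i ∈ I
    · rw [huI a i hi]
      rintro rfl
      exact hsX (hy _ _)
    · rw [huI' a i (Finset.mem_compl.2 hi)]
      exact Finset.ne_of_mem_erase (hw i hi)
  have huVX : ∀ a i, u a i ∈ V ∪ X := by
    intro a i
    by_cases hi : i ∈ I
    · rw [huI a i hi]
      exact Finset.mem_union_right _ (hy _ _)
    · rw [huI' a i (Finset.mem_compl.2 hi)]
      exact Finset.mem_union_left _ (hwV i hi)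
  have huinj : ∀ a, Function.Injective (u a) := by
    intro a i j hij
    by_cases hi : i ∈ I <;> by_cases hj : j ∈ I
    · rw [huI a i hi, huI a j hj] at hij
      exact hinj _ _ _ _ hij
    · rw [huI a i hi, huI' a j (Finset.mem_compl.2 hj)] at hij
      exact absurd (hij ▸ hy i (a i)) (Finset.disjoint_left.1 hVX (hwV j hj))
    · rw [huI' a i (Finset.mem_compl.2 hi), huI a j hj] at hij
      exact absurd (hij ▸ hy j (a j)) (Finset.disjoint_left.1 hVX (hwV i hi))
    · rw [huI' a i (Finset.mem_compl.2 hi), huI' a j (Finset.mem_compl.2 hj)] at hij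
      exact hwinj (Finset.mem_compl.2 hi) (Finset.mem_compl.2 hj) hij
  have hli : ∀ a, LinearIndependent ℝ fun i => lift (u a i) := by
    intro a
    have h := hgp (Finset.univ.image (u a)) (by
      intro v hv
      obtain ⟨i, -, rfl⟩ := Finset.mem_image.1 (Finset.mem_coe.1 hv)
      exact Finset.mem_coe.2 (huVX a i)) (by
      rw [Finset.card_image_of_injective _ (huinj a), Finset.card_univ, Fintype.card_fin])
    rw [Finset.coe_image, Finset.coe_univ, Set.image_univ] at h
    exact (linearIndepOn_range_iff (huinj a) lift).1 h
  have hσu : ∀ a, insert s (Iᶜ.image (u a)) = σ := fun a => by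
    rw [Finset.image_congr (g := w) (huI' a), hwim, Finset.insert_erase hs]
  have hpts : ∀ a, I.image (u a) = pts y I a := fun a => Finset.image_congr (huI a)
  let F := cramerForm b (LinearMap.snd ℝ E ℝ) (lift s)
  obtain ⟨π, -, hπ⟩ := Finset.exists_le_card_fiber_of_nsmul_le_card_of_maps_to
    (s := R) (t := Finset.univ) (f := fun a k => sign (F k fun i => lift (u a i)))
    (b := β / N * ∏ i, (Fintype.card (α i) : ℝ)) (fun _ _ => Finset.mem_univ _)
    Finset.univ_nonempty (by
      rw [nsmul_eq_mul]
      refine le_trans (le_of_eq ?_) hRcard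
      change N * _ = _
      field_simp)
  obtain ⟨a₀, ha₀⟩ :
      (R.filter fun a => (fun k => sign (F k fun i => lift (u a i))) = π).Nonempty := by
    rw [← Finset.card_pos]
    have : 0 < β / N * ∏ i, (Fintype.card (α i) : ℝ) := by positivity
    exact_mod_cast this.trans_le hπ
  obtain ⟨ha₀R, ha₀π⟩ := Finset.mem_filter.1 ha₀
  obtain ⟨Q, hQ, hQπ⟩ := hhom α (fun i a => lift (if i ∈ I then y i a else w i)) F π _
    (fun a ha k => congrFun (Finset.mem_filter.1 ha).2 k) hπ
  refine ⟨Q, hQ, fun a ha => ?_⟩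
  have h := meets_congr_of_sign b (hli a₀) (hus a₀) (hli a) (hus a)
    (fun k => (congrFun ha₀π k).trans (hQπ a ha k).symm) I
  rw [hσu, hσu, hpts, hpts] at h
  exact h.1 (hR a₀ ha₀R)

end Meets

section Limit

variable {E : Type} [NormedAddCommGroup E] [InnerProductSpace ℝ E] [FiniteDimensional ℝ E]

lemma exists_mem_of_infDist_le {κ : Type} {T : Finset κ} (hT : T.Nonempty) {K : κ → Set E}
    (hK : ∀ k, IsCompact (K k)) (hne : ∀ k, (K k).Nonempty)
    (h : ∀ ε > 0, ∃ q, ∀ k ∈ T, Metric.infDist q (K k) ≤ ε) : ∃ p, ∀ k ∈ T, p ∈ K k := by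
  obtain ⟨k₀, hk₀⟩ := hT
  have hmem : ∀ q, Metric.infDist q (K k₀) ≤ 1 → q ∈ Metric.cthickening 1 (K k₀) := by
    intro q hq
    obtain ⟨v, hv, hqv⟩ := (hK k₀).exists_infDist_eq_dist (hne k₀) q
    exact Metric.mem_cthickening_of_dist_le q v 1 _ hv (hqv ▸ hq)
  obtain ⟨p, hp, hmin⟩ := (hK k₀).cthickening (r := 1) |>.exists_isMinOn
    ((hne k₀).mono (Metric.self_subset_cthickening _))
    (f := fun q => ∑ k ∈ T, Metric.infDist q (K k))
    (continuous_finsetSum _ fun k _ => Metric.continuous_infDist_pt _).continuousOn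
  have hzero : ∑ k ∈ T, Metric.infDist p (K k) ≤ 0 := by
    refine le_of_forall_pos_le_add fun δ hδ => ?_
    have hT0 : (0 : ℝ) < T.card := by exact_mod_cast Finset.card_pos.2 ⟨k₀, hk₀⟩
    obtain ⟨q, hq⟩ := h (min 1 (δ / T.card)) (by positivity)
    refine (hmin (hmem q ((hq k₀ hk₀).trans (min_le_left _ _)))).trans ?_
    calc ∑ k ∈ T, Metric.infDist q (K k) ≤ ∑ k ∈ T, δ / T.card :=
          Finset.sum_le_sum fun k hk => (hq k hk).trans (min_le_right _ _)
      _ = 0 + δ := by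
          rw [Finset.sum_const, nsmul_eq_mul]
          field_simp
          simp
  refine ⟨p, fun k hk => ?_⟩
  rw [(hK k).isClosed.mem_iff_infDist_zero (hne k)]
  exact (Finset.sum_eq_zero_iff_of_nonneg fun _ _ => Metric.infDist_nonneg).1
    (hzero.antisymm (Finset.sum_nonneg fun _ _ => Metric.infDist_nonneg)) k hk

lemma exists_approximate_selection (hd : 1 ≤ finrank ℝ E) : ∃ c : ℝ, 0 < c ∧
    ∀ P : Fin (finrank ℝ E + 1) → Finset E, (∀ i, (P i).Nonempty) →
      (∀ i j, i ≠ j → Disjoint (P i) (P j)) → ∀ ε > 0,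
      ∃ (q : E) (Q : Fin (finrank ℝ E + 1) → Finset E), (∀ i, Q i ⊆ P i) ∧
        (∀ i, c * ((P i).card : ℝ) ≤ (Q i).card) ∧
        ∀ x : Fin (finrank ℝ E + 1) → E, (∀ i, x i ∈ Q i) →
          Metric.infDist q (convexHull ℝ (Set.range x)) ≤ ε := by
  classical
  let M : ℝ := (fillConst (finrank ℝ E + 1) (finrank ℝ E + 1) + 1) * 2 ^ (finrank ℝ E + 1)
  have hM : 0 < M := by positivity
  obtain ⟨c, hc, hhom⟩ := exists_homogeneous_meets (E := E) (inv_pos.2 hM)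
  refine ⟨c, hc, fun P hP hdisj ε hε => ?_⟩
  obtain ⟨x, H, V, Z, hxinj, hxdist, hconv, hHX, hZ, hV, hmesh⟩ :=
    exists_perturbation_and_chain hd (Finset.univ.biUnion P) (half_pos hε)
  have hPU : ∀ i, ∀ v ∈ P i, v ∈ Finset.univ.biUnion P := fun i v hv =>
    Finset.mem_biUnion.2 ⟨i, Finset.mem_univ _, hv⟩
  have : ∀ i, Nonempty (P i) := fun i => (hP i).to_subtype
  have hy : ∀ i (a : P i), x a ∈ (Finset.univ.biUnion P).image x := fun i a =>
    Finset.mem_image_of_mem _ (hPU i a a.2)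
  have hinj : ∀ i j (a : P i) (b : P j), x a = x b → i = j := by
    intro i j a b hab
    by_contra hij
    have hval : (a : E) = b := hxinj (hPU i a a.2) (hPU j b b.2) hab
    exact Finset.disjoint_left.1 (hdisj i j hij) a.2 (hval ▸ b.2)
  obtain ⟨σ, I, R, hσ, ⟨s, hs, hσs⟩, hcard, hR, hRcard⟩ :=
    exists_dense_crossing (α := fun i => P i) (y := fun _ a => x a) hZ hconv hHX hV hy hinj
  obtain ⟨Q, hQ, hQmeets⟩ := hhom (fun i => P i) V _ hZ.disjoint hZ.genPos (fun _ a => x a) hy hinj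
    σ (hσs.trans (hZ.subset s hs)) hσ I hcard R hR (by
      rw [inv_mul_le_iff₀ hM]
      rw [Fintype.card_pi, Nat.cast_prod] at hRcard
      exact hRcard)
  obtain ⟨q, hq⟩ := hσ
  refine ⟨q, fun i => (Q i).map (Function.Embedding.subtype _), fun i v hv => ?_, fun i => ?_,
    fun z hz => ?_⟩
  · obtain ⟨a, -, rfl⟩ := Finset.mem_map.1 hv
    exact a.2
  · rw [Finset.card_map]
    simpa using hQ i
  · have hz' : ∀ i, ∃ a ∈ Q i, (a : E) = z i := fun i => Finset.mem_map.1 (hz i)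
    choose a haQ ha using hz'
    obtain ⟨v, hvσ, hvτ⟩ := hQmeets a haQ
    have hvq : dist v q ≤ ε / 2 := by
      have : convexHull ℝ (σ : Set E) ⊆ Metric.closedBall q (ε / 2) :=
        convexHull_min (fun u hu => hmesh s hs u (hσs hu) q (hσs hq)) (convex_closedBall _ _)
      exact this hvσ
    have hvz : v ∈ Metric.thickening (ε / 2) (convexHull ℝ (Set.range z)) := by
      refine convexHull_min (fun u hu => ?_) ((convex_convexHull ℝ _).thickening _) hvτ
      obtain ⟨i, -, rfl⟩ := Finset.mem_image.1 (Finset.mem_coe.1 hu)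
      refine Metric.mem_thickening_iff.2 ⟨z i, subset_convexHull ℝ _ (Set.mem_range_self i), ?_⟩
      rw [← ha i]
      exact hxdist _ (hPU i _ (a i).2)
    obtain ⟨w, hw, hvw⟩ := Metric.mem_thickening_iff.1 hvz
    calc Metric.infDist q (convexHull ℝ (Set.range z)) ≤ dist q w :=
          Metric.infDist_le_dist_of_mem hw
      _ ≤ dist q v + dist v w := dist_triangle _ _ _
      _ ≤ ε := by rw [dist_comm q v]; linarith

/-- Pach's selection theorem for rainbow simplices in a Euclidean space. -/
theorem exists_selection (hd : 1 ≤ finrank ℝ E) : ∃ c : ℝ, 0 < c ∧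
    ∀ P : Fin (finrank ℝ E + 1) → Finset E, (∀ i j, i ≠ j → Disjoint (P i) (P j)) →
      ∃ (p : E) (Q : Fin (finrank ℝ E + 1) → Finset E), (∀ i, Q i ⊆ P i) ∧
        (∀ i, c * ((P i).card : ℝ) ≤ (Q i).card) ∧
        ∀ x : Fin (finrank ℝ E + 1) → E, (∀ i, x i ∈ Q i) →
          p ∈ convexHull ℝ (Set.range x) := by
  classical
  obtain ⟨c, hc, hsel⟩ := exists_approximate_selection (E := E) hd
  refine ⟨min c 1, by positivity, fun P hdisj => ?_⟩
  by_cases hP : ∀ i, (P i).Nonempty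
  swap
  · push Not at hP
    obtain ⟨i, hi⟩ := hP
    refine ⟨0, P, fun _ => subset_rfl, fun j => ?_, fun x hx => ?_⟩
    · exact mul_le_of_le_one_left (Nat.cast_nonneg _) (min_le_right _ _)
    · exact absurd (hx i) (by simp [hi])
  obtain ⟨Q, hQP, hQc, hQ⟩ : ∃ Q : Fin (finrank ℝ E + 1) → Finset E, (∀ i, Q i ⊆ P i) ∧
      (∀ i, c * ((P i).card : ℝ) ≤ (Q i).card) ∧ ∀ ε > 0, ∃ q, ∀ x ∈ Fintype.piFinset Q,
        Metric.infDist q (convexHull ℝ (Set.range x)) ≤ ε := by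
    by_contra! hcon
    have hev : ∀ Q ∈ Fintype.piFinset fun i => (P i).powerset,
        ∀ᶠ ε in nhdsWithin (0 : ℝ) (Set.Ioi 0),
        (∀ i, c * ((P i).card : ℝ) ≤ (Q i).card) → ∀ q, ∃ x ∈ Fintype.piFinset Q,
          ε < Metric.infDist q (convexHull ℝ (Set.range x)) := by
      intro Q hQ
      by_cases hQc : ∀ i, c * ((P i).card : ℝ) ≤ (Q i).card
      · obtain ⟨ε, hε, h⟩ := hcon Q
          (fun i => Finset.mem_powerset.1 (Fintype.mem_piFinset.1 hQ i)) hQc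
        filter_upwards [Ioo_mem_nhdsGT hε] with δ hδ _ q
        obtain ⟨x, hx, hlt⟩ := h q
        exact ⟨x, hx, hδ.2.trans hlt⟩
      · exact Filter.Eventually.of_forall fun _ h => absurd h hQc
    obtain ⟨ε, hε, hε0⟩ := (((Filter.eventually_all_finset _).2 hev).and
      self_mem_nhdsWithin).exists
    obtain ⟨q, Q, hQP, hQc, hQ⟩ := hsel P hP hdisj ε hε0
    obtain ⟨x, hx, hlt⟩ := hε Q
      (Fintype.mem_piFinset.2 fun i => Finset.mem_powerset.2 (hQP i)) hQc q
    exact absurd (hQ x (Fintype.mem_piFinset.1 hx)) (not_le.2 hlt)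
  have hQne : (Fintype.piFinset Q).Nonempty := by
    rw [Fintype.piFinset_nonempty]
    intro i
    have h1 : (0 : ℝ) < (P i).card := by exact_mod_cast (hP i).card_pos
    exact Finset.card_pos.1 (by exact_mod_cast (mul_pos hc h1).trans_le (hQc i))
  obtain ⟨p, hp⟩ := exists_mem_of_infDist_le hQne
    (K := fun x => convexHull ℝ (Set.range x))
    (fun x => (Set.finite_range x).isCompact_convexHull ℝ)
    (fun x => (Set.range_nonempty x).convexHull) hQ
  refine ⟨p, Q, hQP, fun i => ?_, fun x hx => hp x (Fintype.mem_piFinset.2 hx)⟩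
  exact (mul_le_mul_of_nonneg_right (min_le_left _ _) (Nat.cast_nonneg _)).trans (hQc i)

end Limit

end Pach

/-- **Pach's Theorem (without the equal-size restriction).**
For every dimension `d ≥ 1` there exists a constant `c_d > 0` such that for any pairwise
disjoint finite point sets `P 0, …, P d` in `ℝ^d`, there exist a point `p ∈ ℝ^d` and subsets
`Q i ⊆ P i` with `|Q i| ≥ c_d · |P i|` for each `i`, such that for every choice of points
`x i ∈ Q i`, the point `p` lies in the convex hull of `{x 0, …, x d}`. -/
theorem pach_theorem (d : ℕ) (hd : 1 ≤ d) :
    ∃ c : ℝ, 0 < c ∧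
      ∀ P : Fin (d + 1) → Finset (EuclideanSpace ℝ (Fin d)),
        (∀ i j, i ≠ j → Disjoint (P i) (P j)) →
        ∃ (p : EuclideanSpace ℝ (Fin d)) (Q : Fin (d + 1) → Finset (EuclideanSpace ℝ (Fin d))),
          (∀ i, Q i ⊆ P i) ∧
          (∀ i, c * ((P i).card : ℝ) ≤ ((Q i).card : ℝ)) ∧
          ∀ x : Fin (d + 1) → EuclideanSpace ℝ (Fin d),
            (∀ i, x i ∈ Q i) → p ∈ convexHull ℝ (Set.range x) := by
  have h := Pach.exists_selection (E := EuclideanSpace ℝ (Fin d))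
  rw [finrank_euclideanSpace_fin] at h
  exact h hd
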